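/- Let β ∈ (0,∞) and h ∈ ℝ. If ν_{β,h}^+ = ν_{β,h}^{+,−}, then ν_{β,h}^+ is the unique g-measure consistent with P_{β,h}^{+,+}; indeed, any g-measure ν consistent with P_{β,h}^{+,+} satisfies ν_{β,h}^{+,−} ≤ ν ≤ ν_{β,h}^{+,+} in the sense of stochastic domination. -/

import Mathlib

open MeasureTheory Filter Topology ProbabilityTheory

noncomputable section

/-- Spin value of a Boolean spin: `true ↦ +1`, `false ↦ -1`. -/
def sval (b : Bool) : ℝ := if b then 1 else -1

/-- Two-dimensional spin configurations. -/
abbrev Cfg2 := ℤ × ℤ → Bool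

/-- Two-sided sequences over an alphabet `A`. -/
abbrev ZSeq (A : Type*) := ℤ → A

/-- Pasts: index `k` corresponds to the coordinate `-(k+1)`. -/
abbrev Past (A : Type*) := ℕ → A

/-- The four nearest neighbours of a site of `ℤ²`. -/
def nbrs (x : ℤ × ℤ) : Finset (ℤ × ℤ) :=
  {(x.1 + 1, x.2), (x.1 - 1, x.2), (x.1, x.2 + 1), (x.1, x.2 - 1)}

/-- Boltzmann weight
`exp(β[Σ_{{x,y}⊆Λ, x∼y} ω_x ω_y + Σ_{x∈Λ, y∉Λ, x∼y} ω_x σ_y] − h Σ_{x∈Λ} ω_x)`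
(the sum over unordered pairs inside `Λ` is written as half the ordered sum). -/
def isingWeight (β h : ℝ) (Λ : Finset (ℤ × ℤ)) (σ ω : Cfg2) : ℝ :=
  Real.exp (β * ((∑ x ∈ Λ, ∑ y ∈ Λ.filter (fun y => y ∈ nbrs x),
        sval (ω x) * sval (ω y)) / 2
      + ∑ x ∈ Λ, ∑ y ∈ (nbrs x).filter (fun y => y ∉ Λ), sval (ω x) * sval (σ y))
    - h * ∑ x ∈ Λ, sval (ω x))

/-- Fill in the values `τ` inside `Λ` and `σ` outside. -/
def fill (Λ : Finset (ℤ × ℤ)) (σ : Cfg2) (τ : ↥Λ → Bool) : Cfg2 :=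
  fun x => if hx : x ∈ Λ then τ ⟨x, hx⟩ else σ x

/-- The finite-volume Ising measure in `Λ` with boundary condition `σ`, viewed as a measure on
the full configuration space, the spins outside `Λ` being frozen to `σ`. -/
def isingFV (β h : ℝ) (Λ : Finset (ℤ × ℤ)) (σ : Cfg2) : Measure Cfg2 :=
  (∑ τ : ↥Λ → Bool, ENNReal.ofReal (isingWeight β h Λ σ (fill Λ σ τ)))⁻¹ •
    ∑ τ : ↥Λ → Bool,
      ENNReal.ofReal (isingWeight β h Λ σ (fill Λ σ τ)) • Measure.dirac (fill Λ σ τ)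

/-- The box `[-n,n]²`. -/
def box (n : ℕ) : Finset (ℤ × ℤ) :=
  (Finset.Icc (-(n : ℤ)) (n : ℤ)) ×ˢ (Finset.Icc (-(n : ℤ)) (n : ℤ))

/-- Convergence of a sequence of measures on a product space in the sense of convergence of the
measures of all finite-dimensional cylinder events; for probability measures on `{−1,+1}^ι`
this is exactly weak convergence. -/
def CylTendsto {ι A : Type*} [MeasurableSpace A] (μs : ℕ → Measure (ι → A))
    (μ : Measure (ι → A)) : Prop :=
  ∀ (s : Finset ι) (f : ι → A),
    Tendsto (fun n => μs n {η | ∀ i ∈ s, η i = f i}) atTop (𝓝 (μ {η | ∀ i ∈ s, η i = f i}))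

/-- `μ` is the plus phase `μ_{β,h}^+`: the weak limit of the finite-volume Ising measures on
`[-n,n]²` with all-plus boundary conditions. -/
def IsPlusPhase (β h : ℝ) (μ : Measure Cfg2) : Prop :=
  IsProbabilityMeasure μ ∧ CylTendsto (fun n => isingFV β h (box n) (fun _ => true)) μ

/-- `μ` is the minus phase `μ_{β,h}^-`. -/
def IsMinusPhase (β h : ℝ) (μ : Measure Cfg2) : Prop :=
  IsProbabilityMeasure μ ∧ CylTendsto (fun n => isingFV β h (box n) (fun _ => false)) μ

/-- The critical inverse temperature `β_c = ln(1+√2)/2`. -/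
def betaCrit : ℝ := Real.log (1 + Real.sqrt 2) / 2

/-- Projection of a two-dimensional configuration onto the line `ℤ × {0}`. -/
def lineProj (η : Cfg2) : ZSeq Bool := fun i => η (i, 0)

/-- The Schonmann projection of a measure on `{−1,+1}^{ℤ²}`. -/
def schonmann (μ : Measure Cfg2) : Measure (ZSeq Bool) := μ.map lineProj

/-- Restriction of a two-sided sequence to its strict past; index `k` is coordinate `-(k+1)`. -/
def restrictPast {A : Type*} (ω : ZSeq A) : Past A := fun k => ω (-(k + 1 : ℤ))

/-- The shift on two-sided sequences. -/
def shiftSeq {A : Type*} : ZSeq A → ZSeq A := fun ω i => ω (i + 1)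

/-- The σ-algebra `ℱ_{<0}` generated by the coordinates of negative index. -/
def pastSigma (A : Type*) [MeasurableSpace A] : MeasurableSpace (ZSeq A) :=
  MeasurableSpace.comap (fun ω : ZSeq A => restrictPast ω) inferInstance

/-- The σ-algebra generated by the coordinates in `S`. -/
def sigmaOn {ι A : Type*} [MeasurableSpace A] (S : Set ι) : MeasurableSpace (ι → A) :=
  MeasurableSpace.comap (fun ω : ι → A => S.restrict ω) inferInstance

/-- A g-function on the alphabet `A`: measurable, `[0,1]`-valued, normalized. -/
def IsGFunction {A : Type*} [Fintype A] [MeasurableSpace A] (P : A → Past A → ℝ) : Prop :=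
  (∀ a, Measurable (P a)) ∧ ∀ ω, (∑ a : A, P a ω) = 1 ∧ ∀ a, P a ω ∈ Set.Icc (0 : ℝ) 1

/-- `μ` is a translation-invariant g-measure consistent with the g-function `P`: for each `a`,
`ω ↦ P a (restrictPast ω)` is a version of the conditional probability `μ(X₀ = a | ℱ_{<0})`. -/
def IsGMeasure {A : Type*} [MeasurableSpace A] (μ : Measure (ZSeq A))
    (P : A → Past A → ℝ) : Prop :=
  IsProbabilityMeasure μ ∧ μ.map shiftSeq = μ ∧
    ∀ a : A, (fun ω => P a (restrictPast ω))
      =ᵐ[μ] μ[Set.indicator {ω : ZSeq A | ω 0 = a} (fun _ => (1 : ℝ)) | pastSigma A]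

/-- The `k`-th variation of a g-function: the supremum of `|P a ω − P a σ|` over pasts agreeing
on the coordinates `−k,…,−1`. -/
def varG {A : Type*} (P : A → Past A → ℝ) (k : ℕ) : ℝ :=
  sSup {d : ℝ | ∃ (a : A) (ω σ' : Past A), (∀ j < k, ω j = σ' j) ∧ d = |P a ω - P a σ'|}

/-- Elementary conditional probability `μ(B | A)`, as a real number. -/
def condProbR {X : Type*} [MeasurableSpace X] (μ : Measure X) (B A : Set X) : ℝ :=
  ((μ[|A]) B).toReal

/-- The event that `η_i = ω` (suitably reindexed) for `−n ≤ i ≤ −1` and `η_i = b`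
for `−(n+l) ≤ i ≤ −(n+1)`. -/
def pastEvt (n l : ℕ) (b : Bool) (ω : Past Bool) : Set (ZSeq Bool) :=
  {η | (∀ i : ℤ, -(n : ℤ) ≤ i → i ≤ -1 → η i = ω (i.natAbs - 1)) ∧
       (∀ i : ℤ, -((n : ℤ) + l) ≤ i → i ≤ -((n : ℤ) + 1) → η i = b)}

/-- The event that `η_i = b` for `−(n+l) ≤ i ≤ −n`. -/
def blockEvt (n l : ℕ) (b : Bool) : Set (ZSeq Bool) :=
  {η | ∀ i : ℤ, -((n : ℤ) + l) ≤ i → i ≤ -(n : ℤ) → η i = b}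

/-- The event that `η_i = b` for `−n ≤ i ≤ −1`. -/
def allBlock (n : ℕ) (b : Bool) : Set (ZSeq Bool) :=
  {η | ∀ i : ℤ, -(n : ℤ) ≤ i → i ≤ -1 → η i = b}

/-- `P` is the g-function `P^{+,b}` obtained from `ν` by conditioning on the symbol `b`
in the far past: `P(a|ω) = lim_n lim_l ν(η₀ = a | η = b on [−(n+l),−(n+1)], η = ω on [−n,−1])`,
both iterated limits being required to exist. -/
def IsCondG (ν : Measure (ZSeq Bool)) (b : Bool) (P : Bool → Past Bool → ℝ) : Prop :=
  ∀ (a : Bool) (ω : Past Bool), ∃ L : ℕ → ℝ,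
    (∀ n, Tendsto (fun l => condProbR ν {η | η 0 = a} (pastEvt n l b ω)) atTop (𝓝 (L n))) ∧
    Tendsto L atTop (𝓝 (P a ω))

/-- `ν'` is the iterated weak limit `lim_n lim_l ν( · | η = b on [−(n+l),−n])`. -/
def IsCondLimitMeasure (ν : Measure (ZSeq Bool)) (b : Bool) (ν' : Measure (ZSeq Bool)) : Prop :=
  ∃ νseq : ℕ → Measure (ZSeq Bool),
    (∀ n, CylTendsto (fun l => ν[|blockEvt n l b]) (νseq n)) ∧ CylTendsto νseq ν'

/-- Stochastic domination: `ν ≤ μ` iff `ν B ≤ μ B` for every increasing measurable event `B`. -/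
def StochDom {A : Type*} [MeasurableSpace A] [Preorder A]
    (ν μ : Measure (ZSeq A)) : Prop :=
  ∀ B : Set (ZSeq A), MeasurableSet B → (∀ ⦃x y : ZSeq A⦄, x ≤ y → x ∈ B → y ∈ B) → ν B ≤ μ B

/-- `π` is the i.i.d. product measure with `π(η_i = +1) = ρ` for each coordinate. -/
def IsBernoulliProd (ρ : ℝ) (π : Measure (ZSeq Bool)) : Prop :=
  IsProbabilityMeasure π ∧ ∀ (s : Finset ℤ) (f : ℤ → Bool),
    π {η | ∀ i ∈ s, η i = f i} = ∏ i ∈ s, ENNReal.ofReal (if f i then ρ else 1 - ρ)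

/-- Splicing of pasts: coordinates `−k,…,−1` (indices `< k`) from `ω`, the rest from `σ`. -/
def splice {A : Type*} (σ ω : Past A) (k : ℕ) : Past A := fun j => if j < k then ω j else σ j

/-- `ν'` is an extreme point of the convex set of g-measures consistent with `P`. -/
def ExtremeGMeasure (ν' : Measure (ZSeq Bool)) (P : Bool → Past Bool → ℝ) : Prop :=
  IsGMeasure ν' P ∧
  ∀ ν₁ ν₂ : Measure (ZSeq Bool), IsGMeasure ν₁ P → IsGMeasure ν₂ P →
    ∀ t : ℝ, t ∈ Set.Ioo (0 : ℝ) 1 →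
      ν' = ENNReal.ofReal t • ν₁ + ENNReal.ofReal (1 - t) • ν₂ → ν₁ = ν' ∧ ν₂ = ν'

/-- The event that the spins on the line are `−1` on `{−m,…,−n} × {0}`. -/
def lineMinusEvt (n m : ℕ) : Set Cfg2 :=
  {η | ∀ i : ℤ, -(m : ℤ) ≤ i → i ≤ -(n : ℤ) → η (i, 0) = false}

/-- Nearest-neighbour adjacency in `ℤ²` (`‖x−y‖₁ = 1`). -/
def adj2 (x y : ℤ × ℤ) : Prop := (x.1 - y.1).natAbs + (x.2 - y.2).natAbs = 1

/-- The event `A_n`: there is an infinite nearest-neighbour path of `+1` spins starting at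
`(n,0)` entirely contained in the half-plane `{x ≤ n}`. -/
def plusPathEvt (n : ℕ) : Set Cfg2 :=
  {η | ∃ γ : ℕ → ℤ × ℤ, γ 0 = ((n : ℤ), 0) ∧ (∀ j, adj2 (γ j) (γ (j + 1))) ∧
    Function.Injective γ ∧ (∀ j, (γ j).1 ≤ (n : ℤ)) ∧ ∀ j, η (γ j) = true}

/-- The block map for the decimation `ν_{l,k}`: the `j`-th letter consists of the spins on
`[j(k+l), j(k+l)+l−1]`. -/
def blockMap (l k : ℕ) (η : ZSeq Bool) : ZSeq (Fin l → Bool) :=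
  fun j r => η (j * ((k : ℤ) + l) + r)

end

/-- The number of lattice edges joining `M` to its complement. -/
noncomputable def edgeBoundary (M : Finset (ℤ × ℤ)) : ℝ :=
  ∑ x ∈ M, ∑ y ∈ nbrs x, if y ∈ M then 0 else 1

/-- The weight, relative to the all-plus configuration, of the configuration whose minus spins are
exactly the sites of `M`. -/
noncomputable def contourWeight (β h : ℝ) (M : Finset (ℤ × ℤ)) : ℝ :=
  Real.exp (2 * h * M.card - 2 * β * edgeBoundary M)

/-- The configuration whose minus spins are exactly the sites of `M`. -/
def minusOn (M : Finset (ℤ × ℤ)) : Cfg2 := fun x => decide (x ∉ M)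

lemma mem_nbrs_comm {x y : ℤ × ℤ} : y ∈ nbrs x ↔ x ∈ nbrs y := by
  obtain ⟨a, b⟩ := x
  obtain ⟨c, d⟩ := y
  simp only [nbrs, Finset.mem_insert, Finset.mem_singleton, Prod.mk.injEq]
  omega

lemma card_nbrs_le (x : ℤ × ℤ) : (nbrs x).card ≤ 4 := Finset.card_le_four

lemma contourWeight_pos (β h : ℝ) (M : Finset (ℤ × ℤ)) : 0 < contourWeight β h M :=
  Real.exp_pos _

lemma sval_minusOn (M : Finset (ℤ × ℤ)) (x : ℤ × ℤ) :
    sval (minusOn M x) = 1 - 2 * (if x ∈ M then 1 else 0) := by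
  by_cases hx : x ∈ M <;> simp [sval, minusOn, hx]; norm_num

lemma sum_restrict_subset {α : Type*} [DecidableEq α] {M Λ : Finset α} (hM : M ⊆ Λ) (f : α → ℝ) :
    ∑ x ∈ Λ, (if x ∈ M then f x else 0) = ∑ x ∈ M, f x := by
  rw [← Finset.sum_filter]
  congr 1
  ext x
  simpa using fun hx => hM hx

lemma isingWeight_minusOn (β h : ℝ) {Λ M : Finset (ℤ × ℤ)} (hM : M ⊆ Λ) :
    isingWeight β h Λ (fun _ => true) (minusOn M) =
      isingWeight β h Λ (fun _ => true) (fun _ => true) * contourWeight β h M := by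
  unfold isingWeight contourWeight
  rw [← Real.exp_add]
  congr 1
  set χ : ℤ × ℤ → ℝ := fun x => if x ∈ M then 1 else 0 with hχ
  set a : ℤ × ℤ → ℤ × ℤ → ℝ := fun x y => if y ∈ nbrs x then 1 else 0 with ha
  have hasymm : ∀ x y, a x y = a y x := fun x y => by simp only [ha, mem_nbrs_comm (x := x)]
  have hχΛ : ∀ f : ℤ × ℤ → ℝ, ∑ x ∈ Λ, χ x * f x = ∑ x ∈ M, f x := fun f => by
    rw [← sum_restrict_subset hM]
    exact Finset.sum_congr rfl fun x _ => by by_cases hx : x ∈ M <;> simp [hχ, hx]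
  have hs : ∀ x, sval (minusOn M x) = 1 - 2 * χ x := sval_minusOn M
  have ht : sval true = 1 := by simp [sval]
  have hfield : ∑ x ∈ Λ, sval (minusOn M x) = ∑ x ∈ Λ, sval true - 2 * M.card := by
    simp only [hs, ht, Finset.sum_sub_distrib, ← Finset.mul_sum]
    have := hχΛ fun _ => 1
    simp only [mul_one, Finset.sum_const, nsmul_eq_mul] at this
    simp [this]
  have hinner : ∑ x ∈ Λ, ∑ y ∈ Λ.filter (fun y => y ∈ nbrs x),
        sval (minusOn M x) * sval (minusOn M y) =
      ∑ x ∈ Λ, ∑ y ∈ Λ.filter (fun y => y ∈ nbrs x), sval true * sval true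
        - 4 * ∑ x ∈ M, ∑ y ∈ Λ, (1 - χ y) * a x y := by
    have h1 : ∀ F : ℤ × ℤ → ℤ × ℤ → ℝ, ∑ x ∈ Λ, ∑ y ∈ Λ.filter (fun y => y ∈ nbrs x), F x y
        = ∑ x ∈ Λ, ∑ y ∈ Λ, F x y * a x y := fun F => by
      refine Finset.sum_congr rfl fun x _ => ?_
      rw [Finset.sum_filter]
      exact Finset.sum_congr rfl fun y _ => by by_cases hy : y ∈ nbrs x <;> simp [ha, hy]
    have h2 : ∑ x ∈ Λ, ∑ y ∈ Λ, χ y * (1 - χ x) * a x y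
        = ∑ x ∈ Λ, ∑ y ∈ Λ, χ x * (1 - χ y) * a x y := by
      rw [Finset.sum_comm]
      exact Finset.sum_congr rfl fun x _ => Finset.sum_congr rfl fun y _ => by rw [hasymm]
    have h3 : ∑ x ∈ M, ∑ y ∈ Λ, (1 - χ y) * a x y
        = ∑ x ∈ Λ, ∑ y ∈ Λ, χ x * (1 - χ y) * a x y := by
      rw [← hχΛ]
      exact Finset.sum_congr rfl fun x _ => by
        rw [Finset.mul_sum]; exact Finset.sum_congr rfl fun y _ => by ring
    rw [h1, h1, h3]
    have h4 : ∑ x ∈ Λ, ∑ y ∈ Λ, sval (minusOn M x) * sval (minusOn M y) * a x y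
        = ∑ x ∈ Λ, ∑ y ∈ Λ, sval true * sval true * a x y
          - 2 * ∑ x ∈ Λ, ∑ y ∈ Λ, χ x * (1 - χ y) * a x y
          - 2 * ∑ x ∈ Λ, ∑ y ∈ Λ, χ y * (1 - χ x) * a x y := by
      simp only [Finset.mul_sum, ← Finset.sum_sub_distrib]
      refine Finset.sum_congr rfl fun x _ => Finset.sum_congr rfl fun y _ => ?_
      rw [hs, hs, ht]
      ring
    rw [h4, h2]
    ring
  have houter : ∑ x ∈ Λ, ∑ y ∈ (nbrs x).filter (fun y => y ∉ Λ),
        sval (minusOn M x) * sval true =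
      ∑ x ∈ Λ, ∑ y ∈ (nbrs x).filter (fun y => y ∉ Λ), sval true * sval true
        - 2 * ∑ x ∈ M, ∑ y ∈ (nbrs x).filter (fun y => y ∉ Λ), (1 : ℝ) := by
    rw [← hχΛ]
    simp only [Finset.mul_sum, ← Finset.sum_sub_distrib]
    refine Finset.sum_congr rfl fun x _ => Finset.sum_congr rfl fun y _ => ?_
    rw [hs, ht]
    ring
  have hbd : edgeBoundary M = ∑ x ∈ M, ∑ y ∈ Λ, (1 - χ y) * a x y
      + ∑ x ∈ M, ∑ y ∈ (nbrs x).filter (fun y => y ∉ Λ), (1 : ℝ) := by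
    unfold edgeBoundary
    rw [← Finset.sum_add_distrib]
    refine Finset.sum_congr rfl fun x _ => ?_
    rw [← Finset.sum_filter_add_sum_filter_not (nbrs x) (fun y => y ∈ Λ)]
    congr 1
    · have : (nbrs x).filter (fun y => y ∈ Λ) = Λ.filter (fun y => y ∈ nbrs x) := by
        ext y; simp [and_comm]
      rw [this, Finset.sum_filter]
      refine Finset.sum_congr rfl fun y _ => ?_
      by_cases hy : y ∈ M <;> simp [hχ, ha, hy]
    · refine Finset.sum_congr rfl fun y hy => ?_
      rw [if_neg fun h => (Finset.mem_filter.1 hy).2 (hM h)]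
  rw [hfield, hinner, houter, hbd]
  ring

open Classical in
/-- The contour partition function of `Λ` with plus boundary condition, restricted to `E`. -/
noncomputable def partitionOn (β h : ℝ) (Λ : Finset (ℤ × ℤ)) (E : Set Cfg2) : ℝ :=
  ∑ M ∈ Λ.powerset, if minusOn M ∈ E then contourWeight β h M else 0

lemma partitionOn_nonneg (β h : ℝ) (Λ : Finset (ℤ × ℤ)) (E : Set Cfg2) :
    0 ≤ partitionOn β h Λ E :=
  Finset.sum_nonneg fun M _ => by
    split_ifs
    exacts [(contourWeight_pos β h M).le, le_rfl]

lemma partitionOn_univ_pos (β h : ℝ) (Λ : Finset (ℤ × ℤ)) :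
    0 < partitionOn β h Λ Set.univ := by
  simp only [partitionOn, Set.mem_univ, if_true]
  exact Finset.sum_pos (fun M _ => contourWeight_pos β h M) ⟨∅, Finset.empty_mem_powerset _⟩

lemma sum_fill_eq_sum_powerset (Λ : Finset (ℤ × ℤ)) (F : Cfg2 → ℝ) :
    ∑ τ : ↥Λ → Bool, F (fill Λ (fun _ => true) τ) = ∑ M ∈ Λ.powerset, F (minusOn M) := by
  refine Finset.sum_bij' (fun τ _ => Λ.filter fun x => fill Λ (fun _ => true) τ x = false)
    (fun M _ x => minusOn M x) ?_ ?_ ?_ ?_ ?_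
  · intro τ _
    simp
  · simp
  · intro τ _
    ext x
    simp [minusOn, fill]
  · intro M hM
    ext x
    rw [Finset.mem_powerset] at hM
    by_cases hx : x ∈ Λ
    · simp [minusOn, fill, hx]
    · simpa [hx] using fun h => hx (hM h)
  · intro τ _
    congr 1
    ext x
    by_cases hx : x ∈ Λ <;> simp [minusOn, fill, hx]

lemma isingFV_plus_real (β h : ℝ) (Λ : Finset (ℤ × ℤ)) (E : Set Cfg2) :
    (isingFV β h Λ (fun _ => true)).real E =
      partitionOn β h Λ E / partitionOn β h Λ Set.univ := by
  classical
  set c := isingWeight β h Λ (fun _ => true) (fun _ => true) with hc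
  have hcpos : 0 < c := Real.exp_pos _
  have hpart : ∀ E : Set Cfg2, ∑ τ : ↥Λ → Bool,
      (if fill Λ (fun _ => true) τ ∈ E
        then isingWeight β h Λ (fun _ => true) (fill Λ (fun _ => true) τ) else 0)
      = c * partitionOn β h Λ E := fun E => by
    rw [sum_fill_eq_sum_powerset Λ fun ω =>
      if ω ∈ E then isingWeight β h Λ (fun _ => true) ω else 0]
    unfold partitionOn
    rw [Finset.mul_sum]
    refine Finset.sum_congr rfl fun M hM => ?_
    rw [isingWeight_minusOn β h (Finset.mem_powerset.1 hM), mul_ite, mul_zero]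
  have hw : ∀ ω, 0 ≤ isingWeight β h Λ (fun _ => true) ω := fun ω => (Real.exp_pos _).le
  have hnum : (∑ τ : ↥Λ → Bool,
      ENNReal.ofReal (isingWeight β h Λ (fun _ => true) (fill Λ (fun _ => true) τ)) •
        Measure.dirac (fill Λ (fun _ => true) τ)) E = ENNReal.ofReal (c * partitionOn β h Λ E) := by
    rw [← hpart, ENNReal.ofReal_sum_of_nonneg fun τ _ => by split_ifs; exacts [hw _, le_rfl]]
    rw [Measure.finsetSum_apply]
    refine Finset.sum_congr rfl fun τ _ => ?_
    rw [Measure.smul_apply, Measure.dirac_apply, smul_eq_mul]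
    by_cases hE : fill Λ (fun _ => true) τ ∈ E <;> simp [hE]
  have hden : (∑ τ : ↥Λ → Bool,
      ENNReal.ofReal (isingWeight β h Λ (fun _ => true) (fill Λ (fun _ => true) τ)))
      = ENNReal.ofReal (c * partitionOn β h Λ Set.univ) := by
    rw [← hpart, ENNReal.ofReal_sum_of_nonneg fun τ _ => by split_ifs; exacts [hw _, le_rfl]]
    simp
  unfold isingFV Measure.real
  rw [Measure.smul_apply, hnum, hden, smul_eq_mul, ENNReal.toReal_mul, ENNReal.toReal_inv,
    ENNReal.toReal_ofReal (mul_nonneg hcpos.le (partitionOn_nonneg ..)),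
    ENNReal.toReal_ofReal (mul_nonneg hcpos.le (partitionOn_nonneg ..))]
  have := (partitionOn_univ_pos β h Λ).ne'
  field_simp

/-- The cylinder event that a configuration agrees with `f` on `s`. -/
def cyl {ι : Type*} (s : Finset ι) (f : ι → Bool) : Set (ι → Bool) := {η | ∀ i ∈ s, η i = f i}

/-- The event that all spins in `s` are plus. -/
abbrev plusEvt {ι : Type*} (s : Finset ι) : Set (ι → Bool) := cyl s fun _ => true

lemma minusOn_inf (M N : Finset (ℤ × ℤ)) : minusOn M ⊓ minusOn N = minusOn (M ∪ N) := by
  ext x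
  by_cases hM : x ∈ M <;> by_cases hN : x ∈ N <;> simp [minusOn, hM, hN]

lemma minusOn_sup (M N : Finset (ℤ × ℤ)) : minusOn M ⊔ minusOn N = minusOn (M ∩ N) := by
  ext x
  by_cases hM : x ∈ M <;> by_cases hN : x ∈ N <;> simp [minusOn, hM, hN]

lemma edgeBoundary_eq_sum {Λ M : Finset (ℤ × ℤ)} (hM : M ⊆ Λ) :
    edgeBoundary M = ∑ x ∈ Λ, ∑ y ∈ nbrs x, if x ∈ M ∧ y ∉ M then 1 else 0 := by
  rw [edgeBoundary, ← sum_restrict_subset hM]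
  refine Finset.sum_congr rfl fun x _ => ?_
  by_cases hx : x ∈ M <;> simp [hx, ite_not]

lemma edgeBoundary_union_add_inter_le (M N : Finset (ℤ × ℤ)) :
    edgeBoundary (M ∪ N) + edgeBoundary (M ∩ N) ≤ edgeBoundary M + edgeBoundary N := by
  have hi : M ∩ N ⊆ M ∪ N := Finset.inter_subset_left.trans Finset.subset_union_left
  rw [edgeBoundary_eq_sum (Finset.Subset.refl (M ∪ N)), edgeBoundary_eq_sum hi,
    edgeBoundary_eq_sum (Λ := M ∪ N) Finset.subset_union_left,
    edgeBoundary_eq_sum (Λ := M ∪ N) Finset.subset_union_right]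
  simp only [← Finset.sum_add_distrib]
  refine Finset.sum_le_sum fun x _ => Finset.sum_le_sum fun y _ => ?_
  by_cases h1 : x ∈ M <;> by_cases h2 : x ∈ N <;> by_cases h3 : y ∈ M <;> by_cases h4 : y ∈ N <;>
    simp [h1, h2, h3, h4]

lemma contourWeight_mul_le {β : ℝ} (hβ : 0 < β) (h : ℝ) (M N : Finset (ℤ × ℤ)) :
    contourWeight β h M * contourWeight β h N ≤
      contourWeight β h (M ∩ N) * contourWeight β h (M ∪ N) := by
  unfold contourWeight
  rw [← Real.exp_add, ← Real.exp_add, Real.exp_le_exp]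
  have h1 := edgeBoundary_union_add_inter_le M N
  have h2 : ((M ∪ N).card : ℝ) + (M ∩ N).card = M.card + N.card := by
    exact_mod_cast Finset.card_union_add_card_inter M N
  have h3 : 2 * h * ((M ∪ N).card : ℝ) + 2 * h * (M ∩ N).card
      = 2 * h * M.card + 2 * h * N.card := by rw [← mul_add, h2, mul_add]
  nlinarith

lemma partitionOn_mul_le {β : ℝ} (hβ : 0 < β) (h : ℝ) (Λ : Finset (ℤ × ℤ)) {E F G H : Set Cfg2}
    (hinf : ∀ x ∈ E, ∀ y ∈ F, x ⊓ y ∈ G) (hsup : ∀ x ∈ E, ∀ y ∈ F, x ⊔ y ∈ H) :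
    partitionOn β h Λ E * partitionOn β h Λ F ≤ partitionOn β h Λ H * partitionOn β h Λ G := by
  classical
  have hnn : ∀ E : Set Cfg2, (0 : Finset (ℤ × ℤ) → ℝ) ≤
      fun M => if minusOn M ∈ E then contourWeight β h M else 0 := fun E M => by
    dsimp
    split_ifs
    exacts [(contourWeight_pos β h M).le, le_rfl]
  have := Finset.four_functions_theorem Λ (hnn E) (hnn F) (hnn H) (hnn G)
    (fun M _ N _ => ?_) (𝒜 := Λ.powerset) (ℬ := Λ.powerset) subset_rfl subset_rfl
  · rwa [Finset.powerset_infs_powerset_self, Finset.powerset_sups_powerset_self] at this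
  · by_cases hM : minusOn M ∈ E
    · by_cases hN : minusOn N ∈ F
      · have h1 := hinf _ hM _ hN
        have h2 := hsup _ hM _ hN
        rw [minusOn_inf] at h1
        rw [minusOn_sup] at h2
        simpa [hM, hN, h1, h2] using contourWeight_mul_le hβ h M N
      · simpa [hN] using mul_nonneg (hnn H (M ∩ N)) (hnn G (M ∪ N))
    · simpa [hM] using mul_nonneg (hnn H (M ∩ N)) (hnn G (M ∪ N))

lemma partitionOn_inter_plusEvt (β h : ℝ) {Λ Λ' : Finset (ℤ × ℤ)} (hΛ : Λ' ⊆ Λ) (E : Set Cfg2) :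
    partitionOn β h Λ (E ∩ plusEvt (Λ \ Λ')) = partitionOn β h Λ' E := by
  classical
  unfold partitionOn
  refine (Finset.sum_subset_zero_on_sdiff (Finset.powerset_mono.2 hΛ) ?_ ?_).symm
  · intro M hM
    simp only [Finset.mem_sdiff, Finset.mem_powerset] at hM
    refine if_neg fun hE => hM.2 fun x hx => ?_
    by_contra hx'
    have := hE.2 x (Finset.mem_sdiff.2 ⟨hM.1 hx, hx'⟩)
    simp [minusOn, hx] at this
  · intro M hM
    have : minusOn M ∈ plusEvt (Λ \ Λ') := fun x hx => by
      have : x ∉ M := fun h => (Finset.mem_sdiff.1 hx).2 (Finset.mem_powerset.1 hM h)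
      simp [minusOn, this]
    simp [this]

lemma partitionOn_map_add (β h : ℝ) (Λ : Finset (ℤ × ℤ)) (e : ℤ × ℤ) (E : Set Cfg2) :
    partitionOn β h (Λ.map (addRightEmbedding e)) E =
      partitionOn β h Λ ((fun ω x => ω (x - e)) ⁻¹' E) := by
  classical
  unfold partitionOn
  have hconf : ∀ M : Finset (ℤ × ℤ),
      minusOn (M.map (addRightEmbedding e)) = fun x => minusOn M (x - e) := fun M => by
    ext x
    have : x ∈ M.map (addRightEmbedding e) ↔ x - e ∈ M := by
      simp only [Finset.mem_map, addRightEmbedding_apply]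
      exact ⟨fun ⟨y, hy, hyx⟩ => by rwa [← hyx, add_sub_cancel_right], fun hx => ⟨_, hx, by simp⟩⟩
    simp only [minusOn, this]
  have hnb : ∀ x, nbrs (x + e) = (nbrs x).map (addRightEmbedding e) := fun x => by
    ext y
    obtain ⟨a, b⟩ := x
    obtain ⟨c, d⟩ := e
    obtain ⟨u, v⟩ := y
    simp [nbrs]
    omega
  have hbd : ∀ M : Finset (ℤ × ℤ),
      edgeBoundary (M.map (addRightEmbedding e)) = edgeBoundary M := fun M => by
    unfold edgeBoundary
    rw [Finset.sum_map]
    refine Finset.sum_congr rfl fun x _ => ?_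
    rw [addRightEmbedding_apply, hnb, Finset.sum_map]
    simp
  symm
  refine Finset.sum_bij (fun M _ => M.map (addRightEmbedding e)) ?_ ?_ ?_ ?_
  · intro M hM
    simpa using hM
  · intro M _ N _ hMN
    exact Finset.map_injective _ hMN
  · intro N hN
    obtain ⟨M, hM, rfl⟩ := Finset.subset_map_iff.1 (Finset.mem_powerset.1 hN)
    exact ⟨M, Finset.mem_powerset.2 hM, rfl⟩
  · intro M _
    rw [hconf]
    simp [contourWeight, hbd]

/-- A lower bound on the relative weight of two configurations that differ at one site. -/
noncomputable def flipBound (β h : ℝ) : ℝ := Real.exp (-(8 * β + 2 * |h|))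

lemma edgeBoundary_insert (M : Finset (ℤ × ℤ)) {x : ℤ × ℤ} (hx : x ∉ M) :
    |edgeBoundary (insert x M) - edgeBoundary M| ≤ 4 := by
  have hnbr : ∀ x, ∑ y ∈ nbrs x, (1 : ℝ) ≤ 4 := fun x => by
    rw [Finset.sum_const, nsmul_one]
    exact_mod_cast card_nbrs_le x
  have hxx : ∀ y ∈ nbrs x, y ≠ x := fun y hy h => by
    subst h
    obtain ⟨a, b⟩ := y
    simp [nbrs] at hy
    omega
  have h1 : edgeBoundary (insert x M) = ∑ y ∈ nbrs x, (if y ∈ M then (0 : ℝ) else 1)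
      + ∑ z ∈ M, ∑ y ∈ nbrs z, if y ∈ insert x M then (0 : ℝ) else 1 := by
    unfold edgeBoundary
    rw [Finset.sum_insert hx]
    congr 1
    exact Finset.sum_congr rfl fun y hy => by simp [hxx y hy]
  have h2 : edgeBoundary M = ∑ z ∈ M, ∑ y ∈ nbrs z, (if y ∈ insert x M then (0 : ℝ) else 1)
      + ∑ y ∈ nbrs x, if y ∈ M then (1 : ℝ) else 0 := by
    have h3 : ∑ y ∈ nbrs x, (if y ∈ M then (1 : ℝ) else 0)
        = ∑ z ∈ M, ∑ y ∈ nbrs z, if y = x then (1 : ℝ) else 0 := by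
      simp only [Finset.sum_ite_eq', mem_nbrs_comm (y := x), ← Finset.sum_filter]
      congr 1
      ext y
      simp [and_comm]
    rw [h3, ← Finset.sum_add_distrib]
    refine Finset.sum_congr rfl fun z _ => ?_
    rw [← Finset.sum_add_distrib]
    refine Finset.sum_congr rfl fun y _ => ?_
    by_cases hy : y = x
    · subst hy; simp [hx]
    · simp [hy]
  have ha := hnbr x
  have hle : ∀ y ∈ nbrs x, (if y ∈ M then (0 : ℝ) else 1) ≤ 1 := fun y _ => by split_ifs <;> simp
  have hle' : ∀ y ∈ nbrs x, (if y ∈ M then (1 : ℝ) else 0) ≤ 1 := fun y _ => by split_ifs <;> simp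
  have hb := Finset.sum_le_sum hle
  have hb' := Finset.sum_le_sum hle'
  have hc : 0 ≤ ∑ y ∈ nbrs x, (if y ∈ M then (0 : ℝ) else 1) :=
    Finset.sum_nonneg fun y _ => by split_ifs <;> simp
  have hc' : 0 ≤ ∑ y ∈ nbrs x, (if y ∈ M then (1 : ℝ) else 0) :=
    Finset.sum_nonneg fun y _ => by split_ifs <;> simp
  rw [h1, h2, abs_le]
  constructor <;> linarith

lemma flipBound_mul_contourWeight_le {β : ℝ} (hβ : 0 < β) (h : ℝ) (M : Finset (ℤ × ℤ))
    {x : ℤ × ℤ} (hx : x ∉ M) :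
    flipBound β h * contourWeight β h M ≤ contourWeight β h (insert x M) ∧
      flipBound β h * contourWeight β h (insert x M) ≤ contourWeight β h M := by
  unfold flipBound contourWeight
  rw [← Real.exp_add, ← Real.exp_add, Real.exp_le_exp, Real.exp_le_exp,
    Finset.card_insert_of_notMem hx]
  have h1 := abs_le.1 (edgeBoundary_insert M hx)
  have h2 := neg_abs_le h
  have h3 := le_abs_self h
  push_cast
  constructor <;> nlinarith

lemma flipBound_pos (β h : ℝ) : 0 < flipBound β h := Real.exp_pos _

lemma partitionOn_inter_add (β h : ℝ) (Λ : Finset (ℤ × ℤ)) (E : Set Cfg2) (x : ℤ × ℤ) (b : Bool) :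
    partitionOn β h Λ E = partitionOn β h Λ (E ∩ {ω | ω x = b})
      + partitionOn β h Λ (E ∩ {ω | ω x = !b}) := by
  classical
  unfold partitionOn
  rw [← Finset.sum_add_distrib]
  refine Finset.sum_congr rfl fun M _ => ?_
  by_cases hE : minusOn M ∈ E <;> cases b <;> cases hM : minusOn M x <;> simp [hE, hM]

lemma flipBound_mul_partitionOn_le_flip {β : ℝ} (hβ : 0 < β) (h : ℝ) {Λ : Finset (ℤ × ℤ)}
    {E : Set Cfg2} {x : ℤ × ℤ} (hx : x ∈ Λ)
    (hE : ∀ ω ω' : Cfg2, (∀ y, y ≠ x → ω y = ω' y) → (ω ∈ E ↔ ω' ∈ E)) (b : Bool) :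
    flipBound β h * partitionOn β h Λ (E ∩ {ω | ω x = !b}) ≤
      partitionOn β h Λ (E ∩ {ω | ω x = b}) := by
  classical
  have hmem : ∀ M ∈ (Λ.erase x).powerset, x ∉ M ∧
      (minusOn (insert x M) ∈ E ↔ minusOn M ∈ E) ∧ minusOn M x = true ∧
      minusOn (insert x M) x = false := fun M hM => by
    have hxM : x ∉ M := fun h => by simpa using Finset.mem_powerset.1 hM h
    refine ⟨hxM, hE _ _ fun y hy => ?_, ?_, ?_⟩ <;> simp [minusOn, *]
  unfold partitionOn
  rw [← Finset.insert_erase hx, Finset.sum_powerset_insert (by simp),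
    Finset.sum_powerset_insert (by simp), ← Finset.sum_add_distrib, ← Finset.sum_add_distrib,
    Finset.mul_sum]
  refine Finset.sum_le_sum fun M hM => ?_
  obtain ⟨hxM, h1, h2, h3⟩ := hmem M hM
  obtain ⟨h4, h5⟩ := flipBound_mul_contourWeight_le hβ h M hxM
  by_cases hME : minusOn M ∈ E <;> cases b <;> simp [h1, h2, h3, hME, h4, h5]

/-- The probability of an event on the line under the finite-volume plus measure in `box n`. -/
noncomputable def boxProb (β h : ℝ) (n : ℕ) (E : Set (ZSeq Bool)) : ℝ :=
  partitionOn β h (box n) (lineProj ⁻¹' E) / partitionOn β h (box n) Set.univ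

lemma measurableSet_cyl {ι : Type*} (s : Finset ι) (f : ι → Bool) : MeasurableSet (cyl s f) := by
  have : cyl s f = ⋂ i ∈ s, (fun η : ι → Bool => η i) ⁻¹' {f i} := by
    ext η; simp [cyl]
  rw [this]
  exact s.measurableSet_biInter fun i _ => measurable_pi_apply i (measurableSet_singleton _)

lemma cyl_insert {ι : Type*} [DecidableEq ι] (i : ι) (s : Finset ι) (f : ι → Bool) :
    cyl (insert i s) f = cyl s f ∩ {η | η i = f i} := by
  ext η
  simp [cyl, and_comm]

lemma cyl_congr {ι : Type*} {s : Finset ι} {f g : ι → Bool} (hfg : ∀ i ∈ s, f i = g i) :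
    cyl s f = cyl s g := by
  ext η
  exact forall₂_congr fun i hi => by rw [hfg i hi]

lemma cyl_sup {ι : Type*} {s : Finset ι} {f g η ξ : ι → Bool} (hη : η ∈ cyl s f)
    (hξ : ξ ∈ cyl s g) : η ⊔ ξ ∈ cyl s (f ⊔ g) := fun i hi => by
  simp [hη i hi, hξ i hi]

lemma cyl_inf {ι : Type*} {s : Finset ι} {f g η ξ : ι → Bool} (hη : η ∈ cyl s f)
    (hξ : ξ ∈ cyl s g) : η ⊓ ξ ∈ cyl s (f ⊓ g) := fun i hi => by
  simp [hη i hi, hξ i hi]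

lemma measurable_lineProj : Measurable lineProj :=
  measurable_pi_lambda _ fun i => measurable_pi_apply (i, (0 : ℤ))

lemma lineProj_preimage_cyl (s : Finset ℤ) (f : ℤ → Bool) :
    lineProj ⁻¹' cyl s f = cyl (s.image fun i => (i, (0 : ℤ))) fun x => f x.1 := by
  ext η
  simp [cyl, lineProj]

lemma CylTendsto.tendsto_real {ι : Type*} {μs : ℕ → Measure (ι → Bool)} {μ : Measure (ι → Bool)}
    [IsFiniteMeasure μ] (hμ : CylTendsto μs μ) (s : Finset ι) (f : ι → Bool) :
    Tendsto (fun n => (μs n).real (cyl s f)) atTop (𝓝 (μ.real (cyl s f))) :=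
  (ENNReal.tendsto_toReal (measure_ne_top _ _)).comp (hμ s f)

section PlusPhase

variable {β h : ℝ} {μp : Measure Cfg2}

lemma IsPlusPhase.isProbabilityMeasure_schonmann (hμp : IsPlusPhase β h μp) :
    IsProbabilityMeasure (schonmann μp) :=
  have := hμp.1
  Measure.isProbabilityMeasure_map measurable_lineProj.aemeasurable

lemma IsPlusPhase.tendsto_boxProb (hμp : IsPlusPhase β h μp) (s : Finset ℤ) (f : ℤ → Bool) :
    Tendsto (fun n => boxProb β h n (cyl s f)) atTop (𝓝 ((schonmann μp).real (cyl s f))) := by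
  have := hμp.1
  have h1 := hμp.2.tendsto_real (s.image fun i => (i, (0 : ℤ))) fun x => f x.1
  rw [schonmann, map_measureReal_apply measurable_lineProj (measurableSet_cyl s f)]
  rw [← lineProj_preimage_cyl] at h1
  simpa only [isingFV_plus_real, boxProb] using h1

lemma boxProb_mul_le (hβ : 0 < β) (n : ℕ) {E F G H : Set (ZSeq Bool)}
    (hinf : ∀ x ∈ E, ∀ y ∈ F, x ⊓ y ∈ G) (hsup : ∀ x ∈ E, ∀ y ∈ F, x ⊔ y ∈ H) :
    boxProb β h n E * boxProb β h n F ≤ boxProb β h n H * boxProb β h n G := by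
  unfold boxProb
  rw [div_mul_div_comm, div_mul_div_comm]
  have := partitionOn_univ_pos β h (box n)
  refine div_le_div_of_nonneg_right ?_ (mul_pos this this).le
  exact partitionOn_mul_le hβ h _ (G := lineProj ⁻¹' G) (H := lineProj ⁻¹' H)
    (fun x hx y hy => hinf (lineProj x) hx (lineProj y) hy)
    fun x hx y hy => hsup (lineProj x) hx (lineProj y) hy

/-- The strong FKG (lattice) property of the Schonmann projection. -/
lemma IsPlusPhase.schonmann_mul_le (hμp : IsPlusPhase β h μp) (hβ : 0 < β) (s : Finset ℤ)
    (f g : ℤ → Bool) :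
    (schonmann μp).real (cyl s f) * (schonmann μp).real (cyl s g) ≤
      (schonmann μp).real (cyl s (f ⊔ g)) * (schonmann μp).real (cyl s (f ⊓ g)) :=
  le_of_tendsto_of_tendsto' ((hμp.tendsto_boxProb s f).mul (hμp.tendsto_boxProb s g))
    ((hμp.tendsto_boxProb s (f ⊔ g)).mul (hμp.tendsto_boxProb s (f ⊓ g))) fun n =>
    boxProb_mul_le hβ n (fun _ hx _ hy => cyl_inf hx hy) fun _ hx _ hy => cyl_sup hx hy

/-- The finite energy property of the Schonmann projection. -/
lemma IsPlusPhase.flipBound_mul_schonmann_le (hμp : IsPlusPhase β h μp) (hβ : 0 < β)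
    {s : Finset ℤ} {i : ℤ} (hi : i ∉ s) (f : ℤ → Bool) :
    flipBound β h * (schonmann μp).real (cyl s f) ≤
      (1 + flipBound β h) * (schonmann μp).real (cyl (insert i s) f) := by
  refine le_of_tendsto_of_tendsto ((hμp.tendsto_boxProb s f).const_mul _)
    ((hμp.tendsto_boxProb (insert i s) f).const_mul _) ?_
  filter_upwards [eventually_ge_atTop i.natAbs] with n hn
  unfold boxProb
  rw [← mul_div_assoc, ← mul_div_assoc]
  have := partitionOn_univ_pos β h (box n)
  refine div_le_div_of_nonneg_right ?_ this.le
  have hbox : (i, (0 : ℤ)) ∈ box n := by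
    simp [box]
    omega
  have h1 := partitionOn_inter_add β h (box n) (lineProj ⁻¹' cyl s f) (i, 0) (f i)
  have h2 := flipBound_mul_partitionOn_le_flip hβ h hbox (E := lineProj ⁻¹' cyl s f)
    (fun ω ω' hω => forall₂_congr fun j hj => by
      unfold lineProj
      rw [hω (j, 0) fun h => hi (by simpa [← (Prod.mk.inj h).1] using hj)]) (f i)
  have h3 : lineProj ⁻¹' cyl (insert i s) f = lineProj ⁻¹' cyl s f ∩ {ω | ω (i, 0) = f i} := by
    rw [cyl_insert]
    rfl
  rw [h3, h1]
  linarith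

lemma IsPlusPhase.schonmann_cyl_pos (hμp : IsPlusPhase β h μp) (hβ : 0 < β) (s : Finset ℤ)
    (f : ℤ → Bool) : 0 < (schonmann μp).real (cyl s f) := by
  have := hμp.isProbabilityMeasure_schonmann
  induction s using Finset.induction with
  | empty => simp [cyl]
  | insert i s hi ih =>
    have h1 := hμp.flipBound_mul_schonmann_le hβ hi f
    have h2 := flipBound_pos β h
    exact pos_of_mul_pos_right ((mul_pos h2 ih).trans_le h1) (by linarith)

lemma partitionOn_plusEvt_anti (hβ : 0 < β) {Λ Λ' : Finset (ℤ × ℤ)} (hΛ : Λ' ⊆ Λ)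
    (s : Finset (ℤ × ℤ)) :
    partitionOn β h Λ (plusEvt s) / partitionOn β h Λ Set.univ ≤
      partitionOn β h Λ' (plusEvt s) / partitionOn β h Λ' Set.univ := by
  rw [div_le_div_iff₀ (partitionOn_univ_pos ..) (partitionOn_univ_pos ..)]
  rw [← partitionOn_inter_plusEvt β h hΛ (plusEvt s), ← partitionOn_inter_plusEvt β h hΛ Set.univ,
    Set.univ_inter]
  exact partitionOn_mul_le hβ h Λ (fun _ _ _ _ => trivial) fun x hx y hy =>
    ⟨fun i hi => by simp [hx i hi], fun i hi => by simp [hy i hi]⟩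

lemma boxProb_plusEvt_le_shift (hβ : 0 < β) (n : ℕ) (s : Finset ℤ) {e : ℤ} (he : e.natAbs ≤ 1) :
    boxProb β h (n + 1) (plusEvt (s.map (addRightEmbedding e))) ≤ boxProb β h n (plusEvt s) := by
  have hsub : (box n).map (addRightEmbedding ((e, 0) : ℤ × ℤ)) ⊆ box (n + 1) := by
    intro x hx
    simp only [Finset.mem_map, addRightEmbedding_apply, box, Finset.mem_product,
      Finset.mem_Icc] at hx ⊢
    obtain ⟨y, hy, rfl⟩ := hx
    simp only [Prod.fst_add, Prod.snd_add]
    push_cast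
    omega
  have h1 := partitionOn_plusEvt_anti (h := h) hβ hsub
    ((s.map (addRightEmbedding e)).image fun i => (i, (0 : ℤ)))
  rw [partitionOn_map_add, partitionOn_map_add, Set.preimage_univ] at h1
  unfold boxProb
  rw [lineProj_preimage_cyl]
  refine h1.trans_eq ?_
  congr 2
  ext η
  simp [cyl, lineProj]

lemma measure_ext_of_plusEvt {ν ν' : Measure (ZSeq Bool)} [IsProbabilityMeasure ν]
    [IsProbabilityMeasure ν'] (hνν' : ∀ s : Finset ℤ, ν.real (plusEvt s) = ν'.real (plusEvt s)) :
    ν = ν' := by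
  classical
  refine ext_of_generate_finite (Set.range fun s : Finset ℤ => plusEvt s) ?_ ?_ ?_ (by simp)
  · refine le_antisymm ?_ (MeasurableSpace.generateFrom_le ?_)
    · refine iSup_le fun i => ?_
      rintro _ ⟨t, -, rfl⟩
      have htrue : MeasurableSet[MeasurableSpace.generateFrom
          (Set.range fun s : Finset ℤ => plusEvt s)] {η : ZSeq Bool | η i = true} :=
        MeasurableSpace.measurableSet_generateFrom ⟨{i}, by simp [cyl]⟩
      have hm : Measurable[MeasurableSpace.generateFrom
          (Set.range fun s : Finset ℤ => plusEvt s)] fun η : ZSeq Bool => η i :=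
        @measurable_to_bool _ (_) _ htrue
      exact hm trivial
    · rintro _ ⟨s, rfl⟩
      exact measurableSet_cyl _ _
  · rintro _ ⟨s, rfl⟩ _ ⟨t, rfl⟩ -
    refine ⟨s ∪ t, ?_⟩
    ext η
    simp [cyl, or_imp, forall_and]
  · rintro _ ⟨s, rfl⟩
    have := hνν' s
    rwa [measureReal_eq_measureReal_iff] at this

lemma measurable_shiftSeq : Measurable (shiftSeq : ZSeq Bool → ZSeq Bool) :=
  measurable_pi_lambda _ fun i => measurable_pi_apply (i + 1)

lemma shiftSeq_preimage_cyl (s : Finset ℤ) (f : ℤ → Bool) :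
    shiftSeq ⁻¹' cyl s f = cyl (s.map (addRightEmbedding 1)) fun i => f (i - 1) := by
  ext η
  simp [cyl, shiftSeq]

lemma IsPlusPhase.map_shiftSeq_schonmann (hμp : IsPlusPhase β h μp) (hβ : 0 < β) :
    (schonmann μp).map shiftSeq = schonmann μp := by
  have := hμp.isProbabilityMeasure_schonmann
  have : IsProbabilityMeasure ((schonmann μp).map shiftSeq) :=
    Measure.isProbabilityMeasure_map measurable_shiftSeq.aemeasurable
  have hle : ∀ (s : Finset ℤ) (e : ℤ), e.natAbs ≤ 1 →
      (schonmann μp).real (plusEvt (s.map (addRightEmbedding e))) ≤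
        (schonmann μp).real (plusEvt s) := fun s e he =>
    le_of_tendsto_of_tendsto' ((hμp.tendsto_boxProb _ _).comp (tendsto_add_atTop_nat 1))
      (hμp.tendsto_boxProb s _) fun n => boxProb_plusEvt_le_shift hβ n s he
  refine measure_ext_of_plusEvt fun s => ?_
  rw [map_measureReal_apply measurable_shiftSeq (measurableSet_cyl _ _), shiftSeq_preimage_cyl]
  refine le_antisymm (hle s 1 le_rfl) ?_
  have h1 := hle (s.map (addRightEmbedding 1)) (-1) le_rfl
  rwa [Finset.map_map, show (addRightEmbedding (1 : ℤ)).trans (addRightEmbedding (-1)) =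
    Function.Embedding.refl ℤ by ext; simp, Finset.map_refl] at h1

lemma blockEvt_eq_cyl (n l : ℕ) (b : Bool) :
    blockEvt n l b = cyl (Finset.Icc (-((n : ℤ) + l)) (-(n : ℤ))) fun _ => b := by
  ext η
  simp [blockEvt, cyl]

/-- Conditioning on plus spins outside a box raises the probability of plus spins at most to its
value in that box with plus boundary condition. -/
lemma IsPlusPhase.schonmann_inter_blockEvt_le (hμp : IsPlusPhase β h μp) (hβ : 0 < β)
    {m n : ℕ} (hmn : m < n) (l : ℕ) (s : Finset ℤ) :
    (schonmann μp).real (blockEvt n l true ∩ plusEvt s) ≤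
      boxProb β h m (plusEvt s) * (schonmann μp).real (blockEvt n l true) := by
  classical
  have hinter : blockEvt n l true ∩ plusEvt s =
      plusEvt (Finset.Icc (-((n : ℤ) + l)) (-(n : ℤ)) ∪ s) := by
    rw [blockEvt_eq_cyl]
    ext η
    simp [cyl, or_imp, forall_and]
  rw [hinter, blockEvt_eq_cyl]
  refine le_of_tendsto_of_tendsto (hμp.tendsto_boxProb _ _)
    ((hμp.tendsto_boxProb _ _).const_mul _) ?_
  filter_upwards [eventually_ge_atTop (n + l)] with N hN
  unfold boxProb
  rw [div_mul_div_comm, div_le_div_iff₀ (partitionOn_univ_pos ..)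
    (mul_pos (partitionOn_univ_pos ..) (partitionOn_univ_pos ..)),
    mul_comm (partitionOn β h (box m) Set.univ), ← mul_assoc, mul_right_comm]
  refine mul_le_mul_of_nonneg_right ?_ (partitionOn_univ_pos ..).le
  have hsub : box m ⊆ box N := by
    intro x hx
    simp only [box, Finset.mem_product, Finset.mem_Icc] at hx ⊢
    omega
  rw [← partitionOn_inter_plusEvt β h hsub (lineProj ⁻¹' plusEvt s),
    ← partitionOn_inter_plusEvt β h hsub Set.univ,
    Set.univ_inter]
  refine partitionOn_mul_le hβ h _ (fun x hx y hy i hi => ?_) fun x hx y hy =>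
    ⟨fun i hi => ?_, fun i hi => by simp [hy i hi]⟩
  · have h1 := hx i (Finset.mem_union_left _ hi)
    have h2 := hy (i, 0) (by
      simp only [box, Finset.mem_sdiff, Finset.mem_product, Finset.mem_Icc] at hi ⊢
      omega)
    unfold lineProj at h1 ⊢
    simp [h1, h2]
  · have h1 := hx i (Finset.mem_union_right _ hi)
    unfold lineProj at h1 ⊢
    simp [h1]

end PlusPhase

/-- The configuration on the line whose plus spins are exactly the sites of `M`. -/
def plusOn (M : Finset ℤ) : ZSeq Bool := fun i => decide (i ∈ M)

lemma plusOn_mono {M N : Finset ℤ} (hMN : M ⊆ N) : plusOn M ≤ plusOn N := fun i => by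
  by_cases hi : i ∈ M
  · simp [plusOn, hi, hMN hi]
  · simp [plusOn, hi]

lemma measureReal_cyl_add {ι : Type*} (μ : Measure (ι → Bool)) [IsFiniteMeasure μ] (s : Finset ι)
    (f : ι → Bool) (k : ι) :
    μ.real (cyl s f ∩ {η | η k = true}) + μ.real (cyl s f ∩ {η | η k = false}) =
      μ.real (cyl s f) := by
  have hm : MeasurableSet {η : ι → Bool | η k = true} :=
    (measurableSet_singleton true).preimage (measurable_pi_apply k)
  rw [← measureReal_inter_add_sdiff (s := cyl s f) hm]
  congr 2
  ext η
  simp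

/-- The event `B` depends only on the coordinates in `s`. -/
def IsLocal (s : Finset ℤ) (B : Set (ZSeq Bool)) : Prop :=
  ∀ ⦃η ξ : ZSeq Bool⦄, (∀ i ∈ s, η i = ξ i) → η ∈ B → ξ ∈ B

open Classical in
lemma IsLocal.eq_biUnion {s : Finset ℤ} {B : Set (ZSeq Bool)} (hB : IsLocal s B) :
    B = ⋃ M ∈ s.powerset.filter fun M => plusOn M ∈ B, cyl s (plusOn M) := by
  ext η
  simp only [Set.mem_iUnion, Finset.mem_filter, Finset.mem_powerset, exists_prop]
  constructor
  · intro hη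
    have h : ∀ i ∈ s, η i = plusOn (s.filter fun i => η i = true) i := fun i hi => by
      cases hηi : η i <;> simp [plusOn, hi, hηi]
    exact ⟨_, ⟨Finset.filter_subset _ _, hB h hη⟩, h⟩
  · rintro ⟨M, ⟨-, hM⟩, hη⟩
    exact hB (fun i hi => (hη i hi).symm) hM

lemma IsLocal.measurableSet {s : Finset ℤ} {B : Set (ZSeq Bool)} (hB : IsLocal s B) :
    MeasurableSet B := by
  classical
  rw [hB.eq_biUnion]
  exact Finset.measurableSet_biUnion _ fun M _ => measurableSet_cyl _ _

open Classical in
lemma IsLocal.measureReal_eq_sum {s : Finset ℤ} {B : Set (ZSeq Bool)} (hB : IsLocal s B)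
    (μ : Measure (ZSeq Bool)) [IsFiniteMeasure μ] :
    μ.real B = ∑ M ∈ s.powerset, (if plusOn M ∈ B then 1 else 0) * μ.real (cyl s (plusOn M)) := by
  conv_lhs => rw [hB.eq_biUnion]
  rw [measureReal_biUnion_finset ?_ fun M _ => measurableSet_cyl _ _, Finset.sum_filter]
  · simp only [ite_mul, one_mul, zero_mul]
  · intro M hM N hN hMN
    refine Set.disjoint_left.2 fun η hη hη' => hMN ?_
    simp only [Finset.coe_filter, Finset.mem_powerset, Set.mem_ofPred_eq] at hM hN
    ext i
    by_cases hi : i ∈ s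
    · simpa [plusOn] using (hη i hi).symm.trans (hη' i hi)
    · exact iff_of_false (fun h => hi (hM.1 h)) fun h => hi (hN.1 h)

lemma IsLocal.mono {s t : Finset ℤ} {B : Set (ZSeq Bool)} (hB : IsLocal s B) (hst : s ⊆ t) :
    IsLocal t B := fun _ _ h => hB fun i hi => h i (hst hi)

lemma IsLocal.tendsto_measureReal {s : Finset ℤ} {B : Set (ZSeq Bool)} (hB : IsLocal s B)
    {μs : ℕ → Measure (ZSeq Bool)} {μ : Measure (ZSeq Bool)} [IsFiniteMeasure μ]
    [∀ n, IsFiniteMeasure (μs n)] (hμ : CylTendsto μs μ) :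
    Tendsto (fun n => (μs n).real B) atTop (𝓝 (μ.real B)) := by
  classical
  simp only [hB.measureReal_eq_sum]
  exact tendsto_finsetSum _ fun M _ => (hμ.tendsto_real s _).const_mul _

lemma CylTendsto.isProbabilityMeasure {ι : Type*} {μs : ℕ → Measure (ι → Bool)}
    {μ : Measure (ι → Bool)} [∀ n, IsProbabilityMeasure (μs n)] (hμ : CylTendsto μs μ) :
    IsProbabilityMeasure μ := by
  have h := hμ ∅ fun _ => true
  simp only [Finset.notMem_empty, false_imp_iff, implies_true, Set.ofPred_true, measure_univ] at h
  exact ⟨tendsto_nhds_unique h tendsto_const_nhds⟩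

/-- Domination on increasing events depending on finitely many coordinates implies stochastic
domination. -/
lemma stochDom_of_isLocal {ν μ : Measure (ZSeq Bool)} [IsProbabilityMeasure ν]
    [IsProbabilityMeasure μ]
    (hνμ : ∀ (s : Finset ℤ) (B : Set (ZSeq Bool)), IsLocal s B → IsUpperSet B →
      ν.real B ≤ μ.real B) : StochDom ν μ := by
  intro B hB hup
  refine le_of_forall_lt fun r hr => ?_
  obtain ⟨K, hKB, hK, hrK⟩ := hB.exists_lt_isCompact hr
  refine hrK.trans_le ?_
  set U : ℕ → Set (ZSeq Bool) := fun n =>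
    {η | ∃ ξ ∈ K, ∀ i ∈ Finset.Icc (-(n : ℤ)) n, ξ i ≤ η i} with hU
  have hloc : ∀ n : ℕ, IsLocal (Finset.Icc (-(n : ℤ)) n) (U n) := fun n η η' hηη' ⟨ξ, hξ, h⟩ =>
    ⟨ξ, hξ, fun i hi => hηη' i hi ▸ h i hi⟩
  have hupper : ∀ n, IsUpperSet (U n) := fun n η η' hηη' ⟨ξ, hξ, h⟩ =>
    ⟨ξ, hξ, fun i hi => (h i hi).trans (hηη' i)⟩
  have hanti : Antitone U := fun m n hmn η ⟨ξ, hξ, h⟩ => ⟨ξ, hξ, fun i hi => h i (by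
    simp only [Finset.mem_Icc] at hi ⊢
    omega)⟩
  have hsub : ⋂ n, U n ⊆ B := by
    intro η hη
    rw [Set.mem_iInter] at hη
    have hclosed : ∀ n : ℕ,
        IsClosed {ξ : ZSeq Bool | ∀ i ∈ Finset.Icc (-(n : ℤ)) n, ξ i ≤ η i} := fun n => by
      simp only [Set.ofPred_forall]
      refine isClosed_biInter fun i _ => ?_
      have hi : IsClosed ((fun ξ : ZSeq Bool => ξ i) ⁻¹' {b | b ≤ η i}) :=
        (isClosed_discrete _).preimage (continuous_apply i)
      exact hi
    obtain ⟨ξ, hξ⟩ := IsCompact.nonempty_iInter_of_sequence_nonempty_isCompact_isClosed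
      (fun n : ℕ => K ∩ {ξ : ZSeq Bool | ∀ i ∈ Finset.Icc (-(n : ℤ)) n, ξ i ≤ η i})
      (fun n ξ hξ => ⟨hξ.1, fun i hi => hξ.2 i (by
        simp only [Finset.mem_Icc] at hi ⊢
        omega)⟩)
      (fun n => let ⟨ξ, hξ, h⟩ := hη n; ⟨ξ, hξ, h⟩) (hK.inter_right (hclosed 0))
      fun n => hK.isClosed.inter (hclosed n)
    rw [Set.mem_iInter] at hξ
    exact hup (fun i => (hξ i.natAbs).2 i (by simp only [Finset.mem_Icc]; omega)) (hKB (hξ 0).1)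
  have hlim := tendsto_measure_iInter_atTop (μ := μ)
    (fun n => (hloc n).measurableSet.nullMeasurableSet) hanti ⟨0, measure_ne_top _ _⟩
  refine (ge_of_tendsto' hlim fun n => ?_).trans (measure_mono hsub)
  refine (measure_mono (t := U n) fun ξ hξ => ⟨ξ, hξ, fun _ _ => le_rfl⟩).trans ?_
  exact (ENNReal.toReal_le_toReal (measure_ne_top _ _) (measure_ne_top _ _)).1
    (hνμ _ _ (hloc n) (hupper n))

/-- If the conditional probabilities of `ν` given the preceding coordinates dominate those of `ρ`
(for `t = 1`) or are dominated by them (for `t = -1`), and those of `ρ` are monotone, then the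
same comparison holds for expectations of increasing functions. -/
lemma sum_powerset_mul_sub_nonneg {ν ρ : Measure (ZSeq Bool)} [IsProbabilityMeasure ν]
    [IsProbabilityMeasure ρ] (t : ℝ) (m : ℤ)
    (hpos : ∀ (j : ℕ) f, 0 < ρ.real (cyl (Finset.Ico m (m + j)) f))
    (hmono : ∀ (j : ℕ) f g, (∀ i ∈ Finset.Ico m (m + j), f i ≤ g i) →
      ρ.real (cyl (Finset.Ico m (m + j)) f ∩ {η | η (m + j) = true}) *
          ρ.real (cyl (Finset.Ico m (m + j)) g) ≤
        ρ.real (cyl (Finset.Ico m (m + j)) g ∩ {η | η (m + j) = true}) *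
          ρ.real (cyl (Finset.Ico m (m + j)) f))
    (hcomp : ∀ (j : ℕ) f,
      0 ≤ t * (ν.real (cyl (Finset.Ico m (m + j)) f ∩ {η | η (m + j) = true}) *
          ρ.real (cyl (Finset.Ico m (m + j)) f) -
        ρ.real (cyl (Finset.Ico m (m + j)) f ∩ {η | η (m + j) = true}) *
          ν.real (cyl (Finset.Ico m (m + j)) f)))
    (j : ℕ) (F : Finset ℤ → ℝ)
    (hF : ∀ M N, M ⊆ N → N ⊆ Finset.Ico m (m + j) → F M ≤ F N) :
    0 ≤ t * ∑ M ∈ (Finset.Ico m (m + j)).powerset,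
      F M * (ν.real (cyl (Finset.Ico m (m + j)) (plusOn M)) -
        ρ.real (cyl (Finset.Ico m (m + j)) (plusOn M))) := by
  classical
  induction j generalizing F with
  | zero => simp [cyl]
  | succ j ih =>
    specialize hpos j
    specialize hmono j
    specialize hcomp j
    have hs : Finset.Ico m (m + (j + 1 : ℕ)) = insert (m + (j : ℤ)) (Finset.Ico m (m + j)) := by
      rw [Finset.insert_Ico_right_eq_Ico_add_one (by omega)]
      push_cast
      rw [add_assoc]
    have hk : m + (j : ℤ) ∉ Finset.Ico m (m + j) := by simp
    rw [hs] at hF ⊢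
    set s := Finset.Ico m (m + j)
    set k := m + (j : ℤ)
    set g : Finset ℤ → ℝ := fun M =>
      ρ.real (cyl s (plusOn M) ∩ {η | η k = true}) / ρ.real (cyl s (plusOn M)) with hg
    have hg0 : ∀ M, 0 ≤ g M := fun M => by positivity
    have hg1 : ∀ M, g M ≤ 1 := fun M =>
      div_le_one_of_le₀ (measureReal_mono Set.inter_subset_left) measureReal_nonneg
    have hgmono : ∀ M N, M ⊆ N → g M ≤ g N := fun M N hMN =>
      (div_le_div_iff₀ (hpos _) (hpos _)).2 (hmono _ _ fun i _ => plusOn_mono hMN i)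
    have hstep := ih (fun M => F M + g M * (F (insert k M) - F M)) fun M N hMN hN => by
      have h1 := hF M N hMN (hN.trans (Finset.subset_insert k s))
      have h2 := hF (insert k M) (insert k N) (Finset.insert_subset_insert k hMN)
        (Finset.insert_subset_insert k hN)
      have h3 := hF M (insert k M) (Finset.subset_insert k M)
        (Finset.insert_subset_insert k (hMN.trans hN))
      nlinarith [mul_nonneg (sub_nonneg.2 (hg1 N)) (sub_nonneg.2 h1),
        mul_nonneg (hg0 N) (sub_nonneg.2 h2),
        mul_nonneg (sub_nonneg.2 (hgmono M N hMN)) (sub_nonneg.2 h3)]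
    refine hstep.trans ?_
    rw [Finset.sum_powerset_insert hk, ← Finset.sum_add_distrib, Finset.mul_sum, Finset.mul_sum]
    refine Finset.sum_le_sum fun M hM => ?_
    rw [Finset.mem_powerset] at hM
    have hkM : k ∉ M := fun h => hk (hM h)
    have hC0 : cyl (insert k s) (plusOn M) = cyl s (plusOn M) ∩ {η | η k = false} := by
      rw [cyl_insert]
      simp [plusOn, hkM]
    have hC1 : cyl (insert k s) (plusOn (insert k M)) = cyl s (plusOn M) ∩ {η | η k = true} := by
      rw [cyl_insert, cyl_congr (g := plusOn M) fun i hi => ?_]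
      · simp [plusOn]
      · have : i ≠ k := fun h => hk (h ▸ hi)
        simp [plusOn, this]
    rw [hC0, hC1]
    have hν := measureReal_cyl_add ν s (plusOn M) k
    have hρ := measureReal_cyl_add ρ s (plusOn M) k
    have hFk := hF M (insert k M) (Finset.subset_insert k M) (Finset.insert_subset_insert k hM)
    have hgM : g M * ρ.real (cyl s (plusOn M)) =
        ρ.real (cyl s (plusOn M) ∩ {η | η k = true}) := div_mul_cancel₀ _ (hpos _).ne'
    have hcond : 0 ≤ t * (ν.real (cyl s (plusOn M) ∩ {η | η k = true}) -
        g M * ν.real (cyl s (plusOn M))) := by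
      refine nonneg_of_mul_nonneg_left ((hcomp (plusOn M)).trans_eq ?_) (hpos (plusOn M))
      rw [← hgM]
      ring
    have := mul_nonneg hcond (sub_nonneg.2 hFk)
    rw [← hν, ← hρ] at *
    rw [← sub_nonneg]
    refine this.trans_eq ?_
    linear_combination -t * (F (insert k M) - F M) * hgM

/-- Translation by `k`. -/
def shiftBy (k : ℤ) : ZSeq Bool → ZSeq Bool := fun η i => η (i + k)

lemma measurable_shiftBy (k : ℤ) : Measurable (shiftBy k) :=
  measurable_pi_lambda _ fun i => measurable_pi_apply (i + k)

lemma measurePreserving_shiftBy {ν : Measure (ZSeq Bool)} (hν : ν.map shiftSeq = ν) (k : ℤ) :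
    MeasurePreserving (shiftBy k) ν ν := by
  have hnat : ∀ n : ℕ, MeasurePreserving (shiftBy n) ν ν := fun n => by
    induction n with
    | zero =>
      convert MeasurePreserving.id ν
      ext η i
      simp [shiftBy]
    | succ n ih =>
      convert (⟨measurable_shiftSeq, hν⟩ : MeasurePreserving shiftSeq ν ν).comp ih
      ext η i
      simp only [shiftBy, shiftSeq, Function.comp_apply]
      congr 1
      push_cast
      ring
  obtain ⟨n, rfl | rfl⟩ := k.eq_nat_or_neg
  · exact hnat n
  · refine ⟨measurable_shiftBy _, ?_⟩
    conv_lhs => rw [← (hnat n).map_eq]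
    rw [Measure.map_map (measurable_shiftBy _) (measurable_shiftBy _)]
    convert Measure.map_id
    ext η i
    simp [shiftBy]

lemma measureReal_shiftBy_preimage {ν : Measure (ZSeq Bool)} (hν : ν.map shiftSeq = ν) (k : ℤ)
    {E : Set (ZSeq Bool)} (hE : MeasurableSet E) : ν.real (shiftBy k ⁻¹' E) = ν.real E := by
  rw [measureReal_def, measureReal_def,
    (measurePreserving_shiftBy hν k).measure_preimage hE.nullMeasurableSet]

lemma measurableSet_coord (k : ℤ) : MeasurableSet {η : ZSeq Bool | η k = true} :=
  (measurableSet_singleton true).preimage (measurable_pi_apply k)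

lemma measureReal_cyl_inter_mul_le {μ : Measure (ZSeq Bool)} [IsFiniteMeasure μ] {s : Finset ℤ}
    {k : ℤ} (hk : k ∉ s)
    (hμ : ∀ f g : ZSeq Bool, μ.real (cyl (insert k s) f) * μ.real (cyl (insert k s) g) ≤
      μ.real (cyl (insert k s) (f ⊔ g)) * μ.real (cyl (insert k s) (f ⊓ g)))
    {f g : ZSeq Bool} (hfg : ∀ i ∈ s, f i ≤ g i) :
    μ.real (cyl s f ∩ {η | η k = true}) * μ.real (cyl s g) ≤
      μ.real (cyl s g ∩ {η | η k = true}) * μ.real (cyl s f) := by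
  have hne : ∀ i ∈ s, i ≠ k := fun i hi h => hk (h ▸ hi)
  have h := hμ (Function.update f k true) (Function.update g k false)
  simp only [cyl_insert] at h
  rw [cyl_congr (s := s) (f := Function.update f k true) (g := f) fun i hi => by simp [hne i hi],
    cyl_congr (s := s) (f := Function.update g k false) (g := g) fun i hi => by simp [hne i hi],
    cyl_congr (s := s) (f := Function.update f k true ⊔ _) (g := g) fun i hi => by
      simpa [hne i hi, Bool.le_iff_imp] using hfg i hi,
    cyl_congr (s := s) (f := Function.update f k true ⊓ _) (g := f) fun i hi => by
      simpa [hne i hi, Bool.le_iff_imp] using hfg i hi] at h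
  simp only [Function.update_self, Pi.sup_apply, Pi.inf_apply, Bool.sup_eq_bor, Bool.inf_eq_band,
    Bool.or_false, Bool.and_false] at h
  rw [← measureReal_cyl_add μ s f k, ← measureReal_cyl_add μ s g k]
  linarith

/-- Overwrite a configuration by `b` on `(-∞, -n]`. -/
def blockFill (n : ℕ) (b : Bool) (f : ZSeq Bool) : ZSeq Bool :=
  fun i => if i ≤ -(n : ℤ) then b else f i

lemma blockFill_sup (n : ℕ) (b : Bool) (f g : ZSeq Bool) :
    blockFill n b (f ⊔ g) = blockFill n b f ⊔ blockFill n b g := by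
  ext i
  by_cases hi : i ≤ -(n : ℤ) <;> simp [blockFill, hi]

lemma blockFill_inf (n : ℕ) (b : Bool) (f g : ZSeq Bool) :
    blockFill n b (f ⊓ g) = blockFill n b f ⊓ blockFill n b g := by
  ext i
  by_cases hi : i ≤ -(n : ℤ) <;> simp [blockFill, hi]

lemma blockEvt_inter_cyl {n : ℕ} (l : ℕ) (b : Bool) {s : Finset ℤ} (hs : ∀ i ∈ s, -(n : ℤ) < i)
    (f : ZSeq Bool) :
    blockEvt n l b ∩ cyl s f =
      cyl (Finset.Icc (-((n : ℤ) + l)) (-(n : ℤ)) ∪ s) (blockFill n b f) := by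
  have hs' : cyl s f = cyl s (blockFill n b f) :=
    cyl_congr fun i hi => by simp [blockFill, hs i hi]
  have hI : blockEvt n l b = cyl (Finset.Icc (-((n : ℤ) + l)) (-(n : ℤ))) (blockFill n b f) := by
    rw [blockEvt_eq_cyl]
    exact cyl_congr fun i hi => by simp [blockFill, (Finset.mem_Icc.1 hi).2]
  rw [hs', hI]
  ext η
  simp only [cyl, Set.mem_inter_iff, Set.mem_ofPred_eq, Finset.mem_union, or_imp, forall_and]

lemma measureReal_cond {X : Type*} [MeasurableSpace X] {μ : Measure X} {A : Set X}
    (hA : MeasurableSet A) (B : Set X) : (μ[|A]).real B = μ.real (A ∩ B) / μ.real A := by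
  rw [measureReal_def, cond_apply hA, ENNReal.toReal_mul, ENNReal.toReal_inv, div_eq_inv_mul]
  rfl

section Conditioned

variable {β h : ℝ} {μp : Measure Cfg2} {n : ℕ} {b : Bool} {ρ : Measure (ZSeq Bool)}

lemma IsPlusPhase.blockEvt_pos (hμp : IsPlusPhase β h μp) (hβ : 0 < β) (n l : ℕ) (b : Bool) :
    0 < (schonmann μp).real (blockEvt n l b) := by
  rw [blockEvt_eq_cyl]
  exact hμp.schonmann_cyl_pos hβ _ _

lemma IsPlusPhase.isProbabilityMeasure_cond (hμp : IsPlusPhase β h μp) (hβ : 0 < β) (n l : ℕ)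
    (b : Bool) : IsProbabilityMeasure ((schonmann μp)[|blockEvt n l b]) := by
  have := hμp.isProbabilityMeasure_schonmann
  exact cond_isProbabilityMeasure fun h0 => (hμp.blockEvt_pos hβ n l b).ne' (by
    simp [measureReal_def, h0])

lemma measurableSet_blockEvt (n l : ℕ) (b : Bool) : MeasurableSet (blockEvt n l b) := by
  rw [blockEvt_eq_cyl]
  exact measurableSet_cyl _ _

lemma IsPlusPhase.isProbabilityMeasure_of_tendsto (hμp : IsPlusPhase β h μp) (hβ : 0 < β)
    (hρ : CylTendsto (fun l => (schonmann μp)[|blockEvt n l b]) ρ) : IsProbabilityMeasure ρ :=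
  have := fun l => hμp.isProbabilityMeasure_cond hβ n l b
  hρ.isProbabilityMeasure

lemma IsPlusPhase.tendsto_inter_div (hμp : IsPlusPhase β h μp) (hβ : 0 < β)
    (hρ : CylTendsto (fun l => (schonmann μp)[|blockEvt n l b]) ρ) (s : Finset ℤ)
    (f : ZSeq Bool) :
    Tendsto (fun l => (schonmann μp).real (blockEvt n l b ∩ cyl s f) /
      (schonmann μp).real (blockEvt n l b)) atTop (𝓝 (ρ.real (cyl s f))) := by
  have := hμp.isProbabilityMeasure_schonmann
  have := hμp.isProbabilityMeasure_of_tendsto hβ hρ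
  refine (hρ.tendsto_real s f).congr fun l => ?_
  exact measureReal_cond (measurableSet_blockEvt n l b) _

lemma IsPlusPhase.cond_mul_le (hμp : IsPlusPhase β h μp) (hβ : 0 < β)
    (hρ : CylTendsto (fun l => (schonmann μp)[|blockEvt n l b]) ρ) {s : Finset ℤ}
    (hs : ∀ i ∈ s, -(n : ℤ) < i) (f g : ZSeq Bool) :
    ρ.real (cyl s f) * ρ.real (cyl s g) ≤ ρ.real (cyl s (f ⊔ g)) * ρ.real (cyl s (f ⊓ g)) := by
  have hlim := hμp.tendsto_inter_div hβ hρ s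
  refine le_of_tendsto_of_tendsto' ((hlim f).mul (hlim g)) ((hlim _).mul (hlim _)) fun l => ?_
  simp only [blockEvt_inter_cyl l b hs, blockFill_sup, blockFill_inf]
  rw [div_mul_div_comm, div_mul_div_comm]
  exact div_le_div_of_nonneg_right (hμp.schonmann_mul_le hβ _ _ _) (by positivity)

lemma IsPlusPhase.cond_cyl_pos (hμp : IsPlusPhase β h μp) (hβ : 0 < β)
    (hρ : CylTendsto (fun l => (schonmann μp)[|blockEvt n l b]) ρ) {s : Finset ℤ}
    (hs : ∀ i ∈ s, -(n : ℤ) < i) (f : ZSeq Bool) : 0 < ρ.real (cyl s f) := by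
  have := hμp.isProbabilityMeasure_of_tendsto hβ hρ
  induction s using Finset.induction with
  | empty => simp [cyl]
  | insert i s hi ih =>
    specialize ih fun j hj => hs j (Finset.mem_insert_of_mem hj)
    have hlim := fun s => hμp.tendsto_inter_div hβ hρ s f
    have h1 : flipBound β h * ρ.real (cyl s f) ≤
        (1 + flipBound β h) * ρ.real (cyl (insert i s) f) := by
      refine le_of_tendsto_of_tendsto' ((hlim _).const_mul _) ((hlim _).const_mul _) fun l => ?_
      rw [blockEvt_inter_cyl l b hs,
        blockEvt_inter_cyl l b fun j hj => hs j (Finset.mem_insert_of_mem hj),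
        ← mul_div_assoc, ← mul_div_assoc, Finset.union_insert]
      refine div_le_div_of_nonneg_right (hμp.flipBound_mul_schonmann_le hβ ?_ _) (by positivity)
      have := hs i (Finset.mem_insert_self i s)
      simp [hi, this]
    have h2 := flipBound_pos β h
    exact pos_of_mul_pos_right ((mul_pos h2 ih).trans_le h1) (by linarith)

/-- The one-sided conditional probabilities of `ν^+` with plus boundary condition in the far past
dominate (are dominated by) those of the limit of `ν^+` conditioned on minus (plus) spins on
`(-∞, -n]`. -/
lemma IsPlusPhase.condG_compare (hμp : IsPlusPhase β h μp) (hβ : 0 < β)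
    (hρ : CylTendsto (fun l => (schonmann μp)[|blockEvt n l b]) ρ) {Pp : Bool → Past Bool → ℝ}
    (hPp : IsCondG (schonmann μp) true Pp) (j : ℕ) (f : ZSeq Bool) {ω : Past Bool}
    (hω : ∀ i < j, ω i = f (-(n : ℤ) + j - i)) :
    0 ≤ -sval b * (Pp true ω * ρ.real (cyl (Finset.Ico (-(n : ℤ) + 1) (-(n : ℤ) + 1 + j)) f) -
      ρ.real (cyl (Finset.Ico (-(n : ℤ) + 1) (-(n : ℤ) + 1 + j)) f ∩
        {η | η (-(n : ℤ) + 1 + j) = true})) := by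
  have := hμp.isProbabilityMeasure_schonmann
  set k : ℤ := -(n : ℤ) + 1 + j with hk
  set s := Finset.Ico (-(n : ℤ) + 1) k with hs
  have hks : k ∉ s := by simp [hs]
  have hC1 : cyl s f ∩ {η | η k = true} = cyl (insert k s) (Function.update f k true) := by
    rw [cyl_insert, cyl_congr (s := s) (f := Function.update f k true) (g := f) fun i hi => by
      have : i ≠ k := fun h => hks (h ▸ hi)
      simp [this]]
    simp
  obtain ⟨L, hL, hLP⟩ := hPp true ω
  rw [hC1]
  refine ge_of_tendsto (((hLP.mul_const _).sub_const _).const_mul _) ?_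
  filter_upwards [eventually_ge_atTop (j + 1)] with N hN
  have hlim := fun t g => (hμp.tendsto_inter_div hβ hρ t g).comp (tendsto_add_atTop_nat (N - j - 1))
  refine ge_of_tendsto' ((((hL N).mul (hlim _ _)).sub (hlim _ _)).const_mul _) fun l => ?_
  simp only [Function.comp_apply, ← hC1]
  set l' := l + (N - j - 1) with hl'
  set S := Finset.Icc (-((N : ℤ) + l)) (-1) with hS
  set g₁ : ZSeq Bool := fun i => if -(N : ℤ) ≤ i then ω (i.natAbs - 1) else true with hg₁
  set g₂ : ZSeq Bool := fun i => blockFill n b f (i + k) with hg₂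
  have hpast : pastEvt N l true ω = cyl S g₁ := by
    ext η
    constructor
    · rintro ⟨h1, h2⟩ i hi
      rw [hS, Finset.mem_Icc] at hi
      by_cases hiN : -(N : ℤ) ≤ i
      · simp only [hg₁, hiN, if_true]
        exact h1 i hiN hi.2
      · simp only [hg₁, hiN, if_false]
        exact h2 i hi.1 (by omega)
    · intro hη
      refine ⟨fun i h1 h2 => ?_, fun i h1 h2 => ?_⟩
      · have := hη i (Finset.mem_Icc.2 ⟨by omega, h2⟩)
        simpa only [hg₁, h1, if_true] using this
      · have := hη i (Finset.mem_Icc.2 ⟨h1, by omega⟩)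
        simpa only [hg₁, show ¬ -(N : ℤ) ≤ i by omega, if_false] using this
  have hsn : ∀ i ∈ s, -(n : ℤ) < i := fun i hi => by
    rw [hs, Finset.mem_Ico] at hi
    omega
  have hD : shiftBy k ⁻¹' (cyl S g₂) = blockEvt n l' b ∩ cyl s f := by
    rw [blockEvt_inter_cyl l' b hsn]
    ext η
    have hmem : ∀ i, i ∈ Finset.Icc (-((n : ℤ) + l')) (-(n : ℤ)) ∪ s ↔ i - k ∈ S := fun i => by
      simp only [hs, hS, Finset.mem_union, Finset.mem_Icc, Finset.mem_Ico]
      omega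
    constructor
    · intro hη i hi
      simpa [shiftBy, hg₂] using hη (i - k) ((hmem i).1 hi)
    · intro hη i hi
      exact hη (i + k) ((hmem _).2 (by simpa using hi))
  have hD1 : shiftBy k ⁻¹' (cyl S g₂ ∩ {η | η 0 = true}) =
      blockEvt n l' b ∩ (cyl s f ∩ {η | η k = true}) := by
    rw [Set.preimage_inter, hD, Set.inter_assoc]
    simp [shiftBy]
  have hshift := hμp.map_shiftSeq_schonmann hβ
  rw [← hD, ← hD1, measureReal_shiftBy_preimage hshift _ (measurableSet_cyl _ _),
    measureReal_shiftBy_preimage hshift _ ((measurableSet_cyl _ _).inter (measurableSet_coord 0))]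
  have hcond : condProbR (schonmann μp) {η | η 0 = true} (pastEvt N l true ω) =
      (schonmann μp).real (cyl S g₁ ∩ {η | η 0 = true}) / (schonmann μp).real (cyl S g₁) := by
    rw [hpast]
    exact measureReal_cond (measurableSet_cyl _ _) _
  have h0S : (0 : ℤ) ∉ S := by simp [hS]
  have hB := hμp.blockEvt_pos hβ n l' b
  have hP := hμp.schonmann_cyl_pos hβ S g₁
  have hinside : ∀ i : ℤ, -(j : ℤ) ≤ i → i ≤ -1 → g₁ i = g₂ i := fun i h1 h2 => by
    simp only [hg₁, hg₂, blockFill]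
    rw [if_pos (by omega), if_neg (by omega), hω _ (by omega)]
    congr 1
    omega
  have houtside : ∀ i : ℤ, i < -(j : ℤ) → g₂ i = b := fun i h1 => by
    simp only [hg₂, blockFill]
    rw [if_pos (by omega)]
  have hkey : 0 ≤ -sval b * ((schonmann μp).real (cyl S g₁ ∩ {η | η 0 = true}) *
      (schonmann μp).real (cyl S g₂) - (schonmann μp).real (cyl S g₂ ∩ {η | η 0 = true}) *
      (schonmann μp).real (cyl S g₁)) := by
    cases b with
    | false =>
      have := measureReal_cyl_inter_mul_le h0S (hμp.schonmann_mul_le hβ (insert 0 S))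
        (f := g₂) (g := g₁) fun i hi => by
          by_cases hij : -(j : ℤ) ≤ i
          · exact (hinside i hij (Finset.mem_Icc.1 hi).2).ge
          · rw [houtside i (by omega)]
            exact Bool.false_le _
      simp only [sval, Bool.false_eq_true, if_false]
      linarith
    | true =>
      have := measureReal_cyl_inter_mul_le h0S (hμp.schonmann_mul_le hβ (insert 0 S))
        (f := g₁) (g := g₂) fun i hi => by
          by_cases hij : -(j : ℤ) ≤ i
          · exact (hinside i hij (Finset.mem_Icc.1 hi).2).le
          · rw [houtside i (by omega)]
            exact Bool.le_true _
      simp only [sval, if_true]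
      linarith
  rw [hcond]
  refine (div_nonneg hkey (mul_pos hP hB).le).trans_eq ?_
  field_simp

/-- Comparison of the one-step conditional probabilities of a g-measure with those of the limit of
`ν^+` conditioned on a constant block. -/
lemma IsPlusPhase.gMeasure_compare (hμp : IsPlusPhase β h μp) (hβ : 0 < β)
    (hρ : CylTendsto (fun l => (schonmann μp)[|blockEvt n l b]) ρ) {Pp : Bool → Past Bool → ℝ}
    (hPp : IsCondG (schonmann μp) true Pp) {ν : Measure (ZSeq Bool)} (hν : IsGMeasure ν Pp)
    (j : ℕ) (f : ZSeq Bool) :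
    0 ≤ -sval b * (ν.real (cyl (Finset.Ico (-(n : ℤ) + 1) (-(n : ℤ) + 1 + j)) f ∩
          {η | η (-(n : ℤ) + 1 + j) = true}) *
        ρ.real (cyl (Finset.Ico (-(n : ℤ) + 1) (-(n : ℤ) + 1 + j)) f) -
      ρ.real (cyl (Finset.Ico (-(n : ℤ) + 1) (-(n : ℤ) + 1 + j)) f ∩
          {η | η (-(n : ℤ) + 1 + j) = true}) *
        ν.real (cyl (Finset.Ico (-(n : ℤ) + 1) (-(n : ℤ) + 1 + j)) f)) := by
  obtain ⟨hprob, hshift, hcond⟩ := hν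
  have hcomp := fun ω hω => hμp.condG_compare hβ hρ hPp j f (ω := ω) hω
  set k : ℤ := -(n : ℤ) + 1 + j with hk
  set s := Finset.Ico (-(n : ℤ) + 1) k with hs
  set R := ρ.real (cyl s f) with hR
  set R1 := ρ.real (cyl s f ∩ {η | η k = true})
  set E : Set (ZSeq Bool) := cyl (Finset.Icc (-(j : ℤ)) (-1)) fun i => f (i + k) with hE
  have hEeq : shiftBy k ⁻¹' E = cyl s f := by
    ext η
    have hmem : ∀ i, i ∈ s ↔ i - k ∈ Finset.Icc (-(j : ℤ)) (-1) := fun i => by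
      simp only [hs, Finset.mem_Icc, Finset.mem_Ico]
      omega
    constructor
    · intro hη i hi
      simpa [shiftBy] using hη (i - k) ((hmem i).1 hi)
    · intro hη i hi
      exact hη (i + k) ((hmem _).2 (by simpa using hi))
  have hE1 : shiftBy k ⁻¹' (E ∩ {η | η 0 = true}) = cyl s f ∩ {η | η k = true} := by
    rw [Set.preimage_inter, hEeq]
    simp [shiftBy]
  have hEm : MeasurableSet E := measurableSet_cyl _ _
  rw [← hE1, ← hEeq, measureReal_shiftBy_preimage hshift _ hEm,
    measureReal_shiftBy_preimage hshift _ (hEm.inter (measurableSet_coord 0))]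
  have hpast : Measurable (restrictPast : ZSeq Bool → Past Bool) :=
    measurable_pi_lambda _ fun i => measurable_pi_apply _
  have hle : pastSigma Bool ≤ MeasurableSpace.pi := hpast.comap_le
  have hEpast : MeasurableSet[pastSigma Bool] E := by
    have hm : MeasurableSet {ω : Past Bool | ∀ i ∈ Finset.range j, ω i = f (-(n : ℤ) + j - i)} :=
      measurableSet_cyl _ fun i : ℕ => f (-(n : ℤ) + j - i)
    refine ⟨_, hm, ?_⟩
    ext η
    simp only [Set.mem_preimage, Set.mem_ofPred_eq, restrictPast, hE, cyl, Finset.mem_range]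
    constructor
    · intro hη i hi
      rw [Finset.mem_Icc] at hi
      have := hη (i.natAbs - 1) (by omega)
      convert this using 2 <;> omega
    · intro hη i hi
      rw [hη _ (Finset.mem_Icc.2 ⟨by omega, by omega⟩)]
      congr 1
      omega
  have hind : Integrable (Set.indicator {η : ZSeq Bool | η 0 = true} fun _ => (1 : ℝ)) ν :=
    (integrable_const 1).indicator (measurableSet_coord 0)
  have hPint : Integrable (fun η => Pp true (restrictPast η)) ν :=
    integrable_condExp.congr (hcond true).symm
  have hint : ∫ η in E, Pp true (restrictPast η) ∂ν = ν.real (E ∩ {η | η 0 = true}) := by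
    rw [setIntegral_congr_ae hEm ((hcond true).mono fun η hη _ => hη),
      setIntegral_condExp hle hind hEpast, setIntegral_indicator (measurableSet_coord 0)]
    simp
  have hnonneg : 0 ≤ ∫ η in E, -sval b * (Pp true (restrictPast η) * R - R1) ∂ν := by
    refine setIntegral_nonneg hEm fun η hη => hcomp _ fun i hi => ?_
    have := hη (-(i + 1 : ℤ)) (Finset.mem_Icc.2 ⟨by omega, by omega⟩)
    simp only [restrictPast, this]
    congr 1
    omega
  rw [integral_const_mul, integral_sub (hPint.integrableOn.mul_const R) (integrable_const R1),
    integral_mul_const, hint, setIntegral_const, smul_eq_mul, mul_comm (ν.real E)] at hnonneg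
  exact hnonneg

/-- A g-measure compares with the limit of `ν^+` conditioned on a constant block on increasing
events to the right of the block. -/
lemma IsPlusPhase.gMeasure_local_compare (hμp : IsPlusPhase β h μp) (hβ : 0 < β)
    (hρ : CylTendsto (fun l => (schonmann μp)[|blockEvt n l b]) ρ) {Pp : Bool → Past Bool → ℝ}
    (hPp : IsCondG (schonmann μp) true Pp) {ν : Measure (ZSeq Bool)} (hν : IsGMeasure ν Pp)
    {s : Finset ℤ} (hs : s ⊆ Finset.Ico (-(n : ℤ) + 1) (-(n : ℤ) + 1 + (2 * n : ℕ)))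
    {B : Set (ZSeq Bool)} (hB : IsLocal s B) (hup : IsUpperSet B) :
    0 ≤ -sval b * (ν.real B - ρ.real B) := by
  classical
  have := hν.1
  have := hμp.isProbabilityMeasure_of_tendsto hβ hρ
  have hwin : ∀ k, ∀ i ∈ Finset.Ico (-(n : ℤ) + 1) k, -(n : ℤ) < i := fun k i hi => by
    rw [Finset.mem_Ico] at hi
    omega
  have hB' := hB.mono hs
  rw [hB'.measureReal_eq_sum, hB'.measureReal_eq_sum, ← Finset.sum_sub_distrib]
  simp only [← mul_sub]
  refine sum_powerset_mul_sub_nonneg _ _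
    (fun j f => hμp.cond_cyl_pos hβ hρ (hwin _) f)
    (fun j f g hfg => measureReal_cyl_inter_mul_le (by simp)
      (hμp.cond_mul_le hβ hρ fun i hi => ?_) hfg)
    (fun j f => hμp.gMeasure_compare hβ hρ hPp hν j f) (2 * n)
    (fun M => if plusOn M ∈ B then 1 else 0) fun M N hMN _ => ?_
  · obtain rfl | hi := Finset.mem_insert.1 hi
    · omega
    · exact hwin _ i hi
  · have : plusOn M ∈ B → plusOn N ∈ B := hup (plusOn_mono hMN)
    by_cases hM : plusOn M ∈ B
    · simp [hM, this hM]
    · simp only [hM, if_false]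
      split_ifs <;> norm_num

end Conditioned

section CondLimit

variable {β h : ℝ} {μp : Measure Cfg2} {b : Bool} {ν' : Measure (ZSeq Bool)}

lemma IsPlusPhase.isProbabilityMeasure_condLimit (hμp : IsPlusPhase β h μp) (hβ : 0 < β)
    (hν' : IsCondLimitMeasure (schonmann μp) b ν') : IsProbabilityMeasure ν' := by
  obtain ⟨νseq, hseq, hlim⟩ := hν'
  have := fun n => hμp.isProbabilityMeasure_of_tendsto hβ (hseq n)
  exact hlim.isProbabilityMeasure

lemma IsPlusPhase.gMeasure_condLimit_compare (hμp : IsPlusPhase β h μp) (hβ : 0 < β)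
    (hν' : IsCondLimitMeasure (schonmann μp) b ν') {Pp : Bool → Past Bool → ℝ}
    (hPp : IsCondG (schonmann μp) true Pp) {ν : Measure (ZSeq Bool)} (hν : IsGMeasure ν Pp)
    {s : Finset ℤ} {B : Set (ZSeq Bool)} (hB : IsLocal s B) (hup : IsUpperSet B) :
    0 ≤ -sval b * (ν.real B - ν'.real B) := by
  have := hμp.isProbabilityMeasure_condLimit hβ hν'
  obtain ⟨νseq, hseq, hlim⟩ := hν'
  have := fun n => hμp.isProbabilityMeasure_of_tendsto hβ (hseq n)
  refine ge_of_tendsto (((hB.tendsto_measureReal hlim).const_sub _).const_mul _) ?_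
  filter_upwards [eventually_gt_atTop (s.sup Int.natAbs)] with n hn
  refine hμp.gMeasure_local_compare hβ (hseq n) hPp hν (fun i hi => ?_) hB hup
  have : i.natAbs ≤ s.sup Int.natAbs := Finset.le_sup (f := Int.natAbs) hi
  rw [Finset.mem_Ico]
  omega

lemma IsPlusPhase.condLimit_plusEvt_le (hμp : IsPlusPhase β h μp) (hβ : 0 < β)
    (hν' : IsCondLimitMeasure (schonmann μp) true ν') (s : Finset ℤ) :
    ν'.real (plusEvt s) ≤ (schonmann μp).real (plusEvt s) := by
  have := hμp.isProbabilityMeasure_condLimit hβ hν'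
  obtain ⟨νseq, hseq, hlim⟩ := hν'
  refine le_of_tendsto_of_tendsto' ((hlim.tendsto_real s _).comp (tendsto_add_atTop_nat 1))
    (hμp.tendsto_boxProb s _) fun n => ?_
  refine le_of_tendsto' (hμp.tendsto_inter_div hβ (hseq (n + 1)) s _) fun l => ?_
  rw [div_le_iff₀ (hμp.blockEvt_pos hβ _ _ _)]
  exact hμp.schonmann_inter_blockEvt_le hβ n.lt_succ_self l s

end CondLimit

/-- Let `β > 0`, `h ∈ ℝ`. If `ν_{β,h}^+ = ν_{β,h}^{+,-}`, then `ν_{β,h}^+`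
is the unique g-measure consistent with `P_{β,h}^{+,+}`; indeed every g-measure `ν` consistent
with `P^{+,+}` satisfies `ν^{+,-} ≤ ν ≤ ν^{+,+}` in the sense of stochastic domination. -/
theorem uniqueness_from_minus_limit_equality
    (β h : ℝ) (hβ : 0 < β) (μp : Measure Cfg2) (hμp : IsPlusPhase β h μp)
    (Pp : Bool → Past Bool → ℝ) (hPp : IsCondG (schonmann μp) true Pp)
    (νp νm : Measure (ZSeq Bool))
    (hνp : IsCondLimitMeasure (schonmann μp) true νp)
    (hνm : IsCondLimitMeasure (schonmann μp) false νm)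
    (heq : schonmann μp = νm) :
    (∀ ν : Measure (ZSeq Bool), IsGMeasure ν Pp → ν = schonmann μp) ∧
    (∀ ν : Measure (ZSeq Bool), IsGMeasure ν Pp → StochDom νm ν ∧ StochDom ν νp) := by
  have hdom : ∀ ν : Measure (ZSeq Bool), IsGMeasure ν Pp → StochDom νm ν ∧ StochDom ν νp := by
    intro ν hν
    have := hν.1
    have := hμp.isProbabilityMeasure_condLimit hβ hνp
    have := hμp.isProbabilityMeasure_condLimit hβ hνm
    refine ⟨stochDom_of_isLocal fun s B hB hup => ?_, stochDom_of_isLocal fun s B hB hup => ?_⟩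
    · have := hμp.gMeasure_condLimit_compare hβ hνm hPp hν hB hup
      simp only [sval, Bool.false_eq_true, if_false] at this
      linarith
    · have := hμp.gMeasure_condLimit_compare hβ hνp hPp hν hB hup
      simp only [sval, if_true] at this
      linarith
  refine ⟨fun ν hν => ?_, hdom⟩
  have := hν.1
  have := hμp.isProbabilityMeasure_schonmann
  have := hμp.isProbabilityMeasure_condLimit hβ hνp
  obtain ⟨hlow, hhigh⟩ := hdom ν hν
  refine measure_ext_of_plusEvt fun s => ?_
  have hup : ∀ ⦃x y : ZSeq Bool⦄, x ≤ y → x ∈ plusEvt s → y ∈ plusEvt s := fun x y hxy hx i hi =>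
    top_le_iff.1 ((hx i hi).ge.trans (hxy i))
  have hmono : ∀ {ν₁ ν₂ : Measure (ZSeq Bool)} [IsFiniteMeasure ν₂], StochDom ν₁ ν₂ →
      ν₁.real (plusEvt s) ≤ ν₂.real (plusEvt s) := fun hd =>
    ENNReal.toReal_mono (measure_ne_top _ _) (hd _ (measurableSet_cyl _ _) hup)
  exact le_antisymm ((hmono hhigh).trans (hμp.condLimit_plusEvt_le hβ hνp s))
    (heq ▸ hmono hlow)
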